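/- Let s > 0, δ ∈ ℝ, let N ≥ [s] + 1 be an integer, and let F : ℝ^m → ℝ^l be a C^{N+1} function with F(0) = 0. Then there is a constant C such that for every bounded u ∈ H_{s,δ}(ℝ³; ℝ^m), the composition F(u) belongs to H_{s,δ}(ℝ³; ℝ^l) and ‖F(u)‖_{H_{s,δ}} ≤ C ‖F‖_{C^{N+1}} (1 + ‖u‖_{L^∞}^N) ‖u‖_{H_{s,δ}}, where ‖F‖_{C^{N+1}} denotes the supremum over the ball {|y| ≤ ‖u‖_{L^∞}} of the absolute values of all partial derivatives of F of order at most N+1. -/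

import Mathlib

open MeasureTheory Real Set
open scoped FourierTransform ENNReal NNReal

noncomputable section

abbrev E3 : Type := EuclideanSpace ℝ (Fin 3)

/-- A dyadic partition of unity on ℝ³ as in the paper: `ψ j ∈ C_0^∞`, nonnegative,
`supp ψ₀ ⊆ {|x| ≤ 2}`, `ψ₀ = 1` on `{|x| ≤ 1}`, for `j ≥ 1`
`supp ψ_j ⊆ {2^(j-2) ≤ |x| ≤ 2^(j+1)}`, `ψ_j = 1` on `{2^(j-1) ≤ |x| ≤ 2^j}`, and
`|∂^α ψ_j| ≤ C_α 2^(-|α| j)` with `C_α` independent of `j`. -/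
structure DyadicPartition where
  ψ : ℕ → E3 → ℝ
  smooth : ∀ j, ContDiff ℝ (⊤ : ℕ∞) (ψ j)
  nonneg : ∀ j x, 0 ≤ ψ j x
  compSupp : ∀ j, HasCompactSupport (ψ j)
  supp_zero : ∀ x : E3, ψ 0 x ≠ 0 → ‖x‖ ≤ 2
  one_zero : ∀ x : E3, ‖x‖ ≤ 1 → ψ 0 x = 1
  supp_succ : ∀ j : ℕ, 1 ≤ j → ∀ x : E3, ψ j x ≠ 0 →
    (2:ℝ) ^ ((j:ℤ) - 2) ≤ ‖x‖ ∧ ‖x‖ ≤ (2:ℝ) ^ ((j:ℤ) + 1)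
  one_succ : ∀ j : ℕ, 1 ≤ j → ∀ x : E3,
    (2:ℝ) ^ ((j:ℤ) - 1) ≤ ‖x‖ → ‖x‖ ≤ (2:ℝ) ^ (j:ℤ) → ψ j x = 1
  deriv_bound : ∀ n : ℕ, ∃ C : ℝ, ∀ (j : ℕ) (x : E3),
    ‖iteratedFDeriv ℝ n (ψ j) x‖ ≤ C * (2:ℝ) ^ (-(n:ℤ) * (j:ℤ))

/-- The squared `H^s` norm `∫ (1+|ξ|²)^s |𝓕f(ξ)|² dξ` of a complex-valued function. -/
def HsNormSq (s : ℝ) (f : E3 → ℂ) : ℝ≥0∞ :=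
  ∫⁻ ξ : E3, ENNReal.ofReal ((1 + ‖ξ‖ ^ 2) ^ s) * (‖𝓕 f ξ‖₊ : ℝ≥0∞) ^ 2

/-- The squared weighted Sobolev norm
`‖u‖²_{H_{s,δ}} = Σ_j 2^{(3/2+δ)2j} ‖(ψ_j u)_{2^j}‖²_{H^s}`,
where `(ψ_j u)_{2^j}(x) = ψ_j(2^j x) u(2^j x)`. -/
def HwNormSq (P : DyadicPartition) (s δ : ℝ) (u : E3 → ℝ) : ℝ≥0∞ :=
  ∑' j : ℕ, ENNReal.ofReal ((2:ℝ) ^ ((3 + 2 * δ) * (j:ℝ))) *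
    HsNormSq s (fun x : E3 =>
      ((P.ψ j (((2:ℝ) ^ (j:ℕ)) • x) * u (((2:ℝ) ^ (j:ℕ)) • x) : ℝ) : ℂ))

/-- Membership in the weighted Sobolev space `H_{s,δ}` (for functions). -/
def MemH (P : DyadicPartition) (s δ : ℝ) (u : E3 → ℝ) : Prop :=
  LocallyIntegrable u volume ∧ HwNormSq P s δ u < ⊤

/-- The weighted Sobolev norm `‖u‖_{H_{s,δ}}`. -/
def Hnorm (P : DyadicPartition) (s δ : ℝ) (u : E3 → ℝ) : ℝ :=
  Real.sqrt (HwNormSq P s δ u).toReal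

/-- The squared weighted `L²_δ` norm `∫ (1+|x|)^{2δ} |u(x)|² dx`. -/
def L2wNormSq (δ : ℝ) (u : E3 → ℝ) : ℝ≥0∞ :=
  ∫⁻ x : E3, ENNReal.ofReal ((1 + ‖x‖) ^ (2 * δ)) * (‖u x‖₊ : ℝ≥0∞) ^ 2

/-- The weighted `L²_δ` norm. -/
def L2wNorm (δ : ℝ) (u : E3 → ℝ) : ℝ :=
  Real.sqrt (L2wNormSq δ u).toReal

/-- Membership in `L²_δ`. -/
def MemL2w (δ : ℝ) (u : E3 → ℝ) : Prop :=
  AEStronglyMeasurable u volume ∧ L2wNormSq δ u < ⊤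

/-- The partial derivative `∂_a f (x)`. -/
def pd (f : E3 → ℝ) (a : Fin 3) (x : E3) : ℝ :=
  fderiv ℝ f x (EuclideanSpace.single a 1)

open scoped SchwartzMap ContDiff in
/-- On `L¹ ∩ L²` the integral Fourier transform agrees a.e. with the `L²` Fourier transform. -/
theorem fourier_toLp_ae_eq {f : E3 → ℂ} (hf : Integrable f) (hf2 : MemLp f 2) :
    ((𝓕 (hf2.toLp f) : Lp (α := E3) ℂ 2) : E3 → ℂ) =ᵐ[volume] 𝓕 f := by
  have hcont : Continuous (𝓕 f) :=
    VectorFourier.fourierIntegral_continuous continuous_fourierChar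
      (by exact continuous_inner) hf
  refine ae_eq_of_integral_contDiff_smul_eq
    ((Lp.memLp _).locallyIntegrable (by norm_num)) hcont.locallyIntegrable ?_
  intro g g_smooth g_cpt
  have hg₁ : HasCompactSupport (Complex.ofRealCLM ∘ g) := g_cpt.comp_left rfl
  have hg₂ : ContDiff ℝ ∞ (Complex.ofRealCLM ∘ g) := by fun_prop
  set φ : 𝓢(E3, ℂ) := hg₁.toSchwartzMap hg₂ with hφ
  have h1 := congrArg (fun T => T φ) (Lp.fourier_toTemperedDistribution_eq (hf2.toLp f))
  simp only [TemperedDistribution.fourier_apply, Lp.toTemperedDistribution_apply] at h1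
  have h2 : ∫ ξ, 𝓕 f ξ • φ ξ = ∫ x, f x • 𝓕 φ x := by
    simpa using! VectorFourier.integral_fourierIntegral_smul_eq_flip (L := innerₗ E3)
      continuous_fourierChar continuous_inner hf φ.integrable
  have h3 : ∫ x, (𝓕 φ) x • (hf2.toLp f : E3 → ℂ) x = ∫ x, f x • 𝓕 φ x := by
    refine integral_congr_ae ?_
    filter_upwards [hf2.coeFn_toLp] with x hx
    rw [hx, smul_eq_mul, smul_eq_mul, mul_comm]
  have h4 : ∀ (k : E3 → ℂ), ∫ x, g x • k x = ∫ x, φ x • k x := by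
    intro k; rfl
  rw [h4, h4, ← h1, h3, ← h2]
  simp only [smul_eq_mul, mul_comm]

/-- The Plancherel identity for functions in `L¹ ∩ L²`. -/
theorem lintegral_fourier_sq {f : E3 → ℂ} (hf : Integrable f) (hf2 : MemLp f 2) :
    ∫⁻ ξ, ‖𝓕 f ξ‖ₑ ^ 2 = ∫⁻ x, ‖f x‖ₑ ^ 2 := by
  have key : eLpNorm (𝓕 f) 2 volume = eLpNorm f 2 volume := by
    rw [← eLpNorm_congr_ae (fourier_toLp_ae_eq hf hf2), ← eLpNorm_congr_ae hf2.coeFn_toLp,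
      ← Lp.enorm_def, ← Lp.enorm_def, ← ofReal_norm, ← ofReal_norm, Lp.norm_fourier_eq]
  have h := congrArg (fun t : ℝ≥0∞ => t ^ (2 : ℝ)) key
  simp only [eLpNorm_eq_lintegral_rpow_enorm_toReal (p := 2) (by norm_num) (by norm_num)] at h
  rw [← ENNReal.rpow_mul, ← ENNReal.rpow_mul] at h
  simpa using h

theorem integrable_fwdDiff_iter {V : Type*} [NormedAddCommGroup V] {f : E3 → V}
    (hf : Integrable f) (h : E3) (n : ℕ) : Integrable ((fwdDiff h)^[n] f) := by
  induction n with
  | zero => simpa using hf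
  | succ n ih =>
    rw [Function.iterate_succ_apply']
    exact (ih.comp_add_right h).sub ih

theorem memLp_fwdDiff_iter {V : Type*} [NormedAddCommGroup V] {f : E3 → V} {p : ℝ≥0∞}
    (hf : MemLp f p) (h : E3) (n : ℕ) : MemLp ((fwdDiff h)^[n] f) p := by
  induction n with
  | zero => simpa using hf
  | succ n ih =>
    rw [Function.iterate_succ_apply']
    exact (ih.comp_measurePreserving (measurePreserving_add_right volume h)).sub ih

theorem fourier_fwdDiff_iter {f : E3 → ℂ} (hf : Integrable f) (h ξ : E3) (n : ℕ) :
    𝓕 ((fwdDiff h)^[n] f) ξ = ((𝐞 (inner ℝ h ξ) : ℂ) - 1) ^ n * 𝓕 f ξ := by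
  induction n with
  | zero => simp
  | succ n ih =>
    rw [Function.iterate_succ_apply']
    set g := (fwdDiff h)^[n] f with hg
    have hgi : Integrable g := integrable_fwdDiff_iter hf h n
    have h1 : 𝓕 (fun x => g (x + h)) ξ = 𝐞 (inner ℝ h ξ) • 𝓕 g ξ :=
      congrFun (VectorFourier.fourierIntegral_comp_add_right 𝐞 volume (innerₗ E3) g h) ξ
    have h2 : 𝓕 (fwdDiff h g) ξ = 𝓕 (fun x => g (x + h)) ξ - 𝓕 g ξ := by
      rw [Real.fourier_eq, Real.fourier_eq, Real.fourier_eq, ← integral_sub]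
      · simp only [fwdDiff, smul_sub]
      · exact (Real.fourierIntegral_convergent_iff ξ).2 (hgi.comp_add_right h)
      · exact (Real.fourierIntegral_convergent_iff ξ).2 hgi
    rw [h2, h1, ih, Circle.smul_def, smul_eq_mul]
    ring

theorem lintegral_fwdDiff_iter_sq {f : E3 → ℂ} (hf : Integrable f) (hf2 : MemLp f 2)
    (h : E3) (n : ℕ) :
    ∫⁻ x, ‖(fwdDiff h)^[n] f x‖ₑ ^ 2 =
      ∫⁻ ξ, ‖(𝐞 (inner ℝ h ξ) : ℂ) - 1‖ₑ ^ (2 * n) * ‖𝓕 f ξ‖ₑ ^ 2 := by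
  rw [← lintegral_fourier_sq (integrable_fwdDiff_iter hf h n) (memLp_fwdDiff_iter hf2 h n)]
  refine lintegral_congr fun ξ => ?_
  rw [fourier_fwdDiff_iter hf, enorm_mul, enorm_pow, mul_pow, ← pow_mul, mul_comm n]

theorem norm_fourierChar_sub_one (t : ℝ) : ‖(𝐞 t : ℂ) - 1‖ = 2 * |sin (π * t)| := by
  have h := Complex.norm_exp_I_mul_ofReal_sub_one (2 * π * t)
  rw [Real.fourierChar_apply, mul_comm, h, norm_mul, Real.norm_eq_abs, Real.norm_eq_abs]
  rw [show 2 * π * t / 2 = π * t by ring]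
  simp

theorem norm_fourierChar_inner_sub_one_le (h ξ : E3) :
    ‖(𝐞 (inner ℝ h ξ) : ℂ) - 1‖ ≤ 2 * π * min 1 (‖h‖ * ‖ξ‖) := by
  rw [norm_fourierChar_sub_one]
  have hpi := Real.pi_gt_three
  rcases min_choice 1 (‖h‖ * ‖ξ‖) with h1 | h1 <;> rw [h1]
  · have := Real.abs_sin_le_one (π * inner ℝ h ξ)
    nlinarith
  · have h2 : |sin (π * inner ℝ h ξ)| ≤ |π * inner ℝ h ξ| := Real.abs_sin_le_abs
    have h3 := abs_real_inner_le_norm h ξ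
    rw [abs_mul, abs_of_pos Real.pi_pos] at h2
    nlinarith

theorem one_le_norm_fourierChar_sub_one {t : ℝ} (h1 : 1 / 4 ≤ t) (h2 : t ≤ 3 / 4) :
    1 ≤ ‖(𝐞 t : ℂ) - 1‖ := by
  rw [norm_fourierChar_sub_one]
  have hs : 1 / 2 ≤ sin (π * t) := by
    have hc : sin (π * t) = cos (π * |t - 1 / 2|) := by
      rw [← abs_of_pos Real.pi_pos, ← abs_mul, Real.cos_abs, abs_of_pos Real.pi_pos,
        ← Real.cos_pi_div_two_sub, ← Real.cos_neg]
      congr 1; ring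
    have ha : |t - 1 / 2| ≤ 1 / 4 := abs_le.2 ⟨by linarith, by linarith⟩
    have hle : cos (π / 3) ≤ cos (π * |t - 1 / 2|) := by
      refine Real.cos_le_cos_of_nonneg_of_le_pi (by positivity) ?_ ?_ <;> nlinarith [Real.pi_pos]
    rw [Real.cos_pi_div_three] at hle
    rwa [hc]
  have := le_abs_self (sin (π * t))
  linarith

theorem lintegral_comp_smul_E3 {c : ℝ} (hc : 0 < c) (g : E3 → ℝ≥0∞) :
    ∫⁻ x, g (c • x) = ENNReal.ofReal ((c ^ 3)⁻¹) * ∫⁻ x, g x := by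
  have hemb : MeasurableEmbedding (fun x : E3 => c • x) :=
    (Homeomorph.smulOfNeZero c hc.ne').measurableEmbedding
  have h := hemb.lintegral_map g (μ := volume)
  rw [Measure.map_addHaar_smul volume hc.ne', lintegral_smul_measure] at h
  rw [← h]
  simp [abs_of_pos hc]

/-- The weight `|h|^{-3-2s}` of the difference seminorms. -/
def diffWeight (s : ℝ) (h : E3) : ℝ≥0∞ := ENNReal.ofReal (‖h‖ ^ (-(3 + 2 * s)))

theorem measurable_diffWeight (s : ℝ) : Measurable (diffWeight s) := by
  unfold diffWeight; fun_prop

theorem lintegral_diffWeight_comp_smul (s : ℝ) {c : ℝ} (hc : 0 < c) (Φ : E3 → ℝ≥0∞) :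
    ∫⁻ h, diffWeight s h * Φ (c • h) =
      ENNReal.ofReal (c ^ (2 * s)) * ∫⁻ h, diffWeight s h * Φ h := by
  have h1 : ∀ h : E3, diffWeight s h * Φ (c • h) =
      ENNReal.ofReal (c ^ (3 + 2 * s)) * (diffWeight s (c • h) * Φ (c • h)) := by
    intro h
    rw [← mul_assoc]
    congr 1
    unfold diffWeight
    rw [← ENNReal.ofReal_mul (by positivity), norm_smul, Real.norm_eq_abs, abs_of_pos hc,
      Real.mul_rpow hc.le (norm_nonneg _), ← mul_assoc, ← Real.rpow_add hc]
    simp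
  simp_rw [h1]
  rw [lintegral_const_mul' _ _ ENNReal.ofReal_ne_top,
    lintegral_comp_smul_E3 hc (fun h => diffWeight s h * Φ h), ← mul_assoc,
    ← ENNReal.ofReal_mul (by positivity)]
  congr 2
  rw [Real.rpow_add hc, Real.rpow_ofNat]
  field_simp

theorem integrable_rpow_norm_mul_min {s : ℝ} (hs : 0 < s) {N : ℕ} (hN : s < N) :
    Integrable (fun h : E3 => ‖h‖ ^ (-(3 + 2 * s)) * (min 1 ‖h‖) ^ (2 * N)) := by
  refine (integrable_fun_norm_addHaar (volume : Measure E3)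
    (f := fun y : ℝ => y ^ (-(3 + 2 * s)) * (min 1 y) ^ (2 * N))).2 ?_
  rw [← Ioc_union_Ioi_eq_Ioi (zero_le_one' ℝ)]
  have hdim : Module.finrank ℝ E3 - 1 = 2 := by simp
  simp only [hdim, smul_eq_mul]
  refine IntegrableOn.union ?_ ?_
  · have h1 : IntegrableOn (fun y : ℝ => y ^ (2 * (N : ℝ) - 1 - 2 * s)) (Ioc 0 1) := by
      rw [← intervalIntegrable_iff_integrableOn_Ioc_of_le zero_le_one]
      exact intervalIntegral.intervalIntegrable_rpow' (by linarith)
    refine h1.congr_fun (fun y hy => ?_) measurableSet_Ioc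
    simp only
    rw [min_eq_right hy.2, ← Real.rpow_natCast y 2, ← Real.rpow_natCast y (2 * N),
      ← Real.rpow_add hy.1, ← Real.rpow_add hy.1]
    congr 1; push_cast; ring
  · have h1 : IntegrableOn (fun y : ℝ => y ^ (-1 - 2 * s)) (Ioi 1) :=
      integrableOn_Ioi_rpow_of_lt (by linarith) zero_lt_one
    refine h1.congr_fun (fun y hy => ?_) measurableSet_Ioi
    have hy1 : (1 : ℝ) < y := hy
    have hy0 : (0 : ℝ) < y := by linarith
    simp only
    rw [min_eq_left hy1.le, one_pow, mul_one, ← Real.rpow_natCast y 2, ← Real.rpow_add hy0]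
    congr 1; push_cast; ring

theorem lintegral_diffWeight_mul_min_lt_top {s : ℝ} (hs : 0 < s) {N : ℕ} (hN : s < N) :
    ∫⁻ h, diffWeight s h * ENNReal.ofReal ((min 1 ‖h‖) ^ (2 * N)) < ⊤ := by
  have h := (integrable_rpow_norm_mul_min hs hN).lintegral_lt_top
  refine lt_of_eq_of_lt (lintegral_congr fun x => ?_) h
  rw [diffWeight, ENNReal.ofReal_mul (by positivity)]

theorem lintegral_diffWeight_far_lt_top {s : ℝ} (hs : 0 < s) {η : ℝ} (hη : 0 < η) :
    ∫⁻ h, diffWeight s h * (Ioi η).indicator 1 ‖h‖ < ⊤ := by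
  obtain ⟨N, hN⟩ := exists_nat_gt s
  have hm : 0 < (min 1 η) ^ (2 * N) := by positivity
  have h1 : ∀ h : E3, diffWeight s h * (Ioi η).indicator 1 ‖h‖ ≤
      ENNReal.ofReal ((min 1 η) ^ (2 * N))⁻¹ *
        (diffWeight s h * ENNReal.ofReal ((min 1 ‖h‖) ^ (2 * N))) := by
    intro h
    by_cases hh : η < ‖h‖
    · rw [indicator_of_mem (by exact hh), mul_left_comm]
      gcongr
      rw [← ENNReal.ofReal_mul (by positivity), Pi.one_apply]
      apply ENNReal.one_le_ofReal.2
      rw [le_inv_mul_iff₀ hm, mul_one]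
      gcongr
    · rw [indicator_of_notMem (by exact hh)]; simp
  refine (lintegral_mono h1).trans_lt ?_
  rw [lintegral_const_mul' _ _ ENNReal.ofReal_ne_top]
  exact ENNReal.mul_lt_top ENNReal.ofReal_lt_top (lintegral_diffWeight_mul_min_lt_top hs hN)

/-- The mixed symbol integral is dominated by the symbol of `H^s`. -/
theorem exists_symbol_le {s : ℝ} (hs : 0 < s) {N : ℕ} (hN : s < N) :
    ∃ C : ℝ, 0 ≤ C ∧ ∀ (ξ : E3) (k : ℕ), k ≤ N →
      ∫⁻ h, diffWeight s h * (ENNReal.ofReal ((min 1 ‖h‖) ^ (2 * k)) *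
        ‖(𝐞 (inner ℝ h ξ) : ℂ) - 1‖ₑ ^ (2 * (N - k))) ≤
      ENNReal.ofReal C * ENNReal.ofReal ((1 + ‖ξ‖ ^ 2) ^ s) := by
  set J := ∫⁻ h, diffWeight s h * ENNReal.ofReal ((min 1 ‖h‖) ^ (2 * N)) with hJ
  have hJt : J < ⊤ := lintegral_diffWeight_mul_min_lt_top hs hN
  refine ⟨(2 * π) ^ (2 * N) * J.toReal, by positivity, fun ξ k hk => ?_⟩
  set R : ℝ := √(1 + ‖ξ‖ ^ 2) with hR
  have hR1 : 1 ≤ R := Real.one_le_sqrt.2 (by nlinarith [norm_nonneg ξ])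
  have hR0 : 0 < R := by linarith
  have hRξ : ‖ξ‖ ≤ R := Real.le_sqrt_of_sq_le (by linarith)
  have hRs : R ^ (2 * s) = (1 + ‖ξ‖ ^ 2) ^ s := by
    rw [Real.rpow_mul hR0.le, Real.rpow_two, Real.sq_sqrt (by positivity)]
  have hpt : ∀ h : E3, diffWeight s h * (ENNReal.ofReal ((min 1 ‖h‖) ^ (2 * k)) *
        ‖(𝐞 (inner ℝ h ξ) : ℂ) - 1‖ₑ ^ (2 * (N - k))) ≤
      ENNReal.ofReal ((2 * π) ^ (2 * N)) *
        (diffWeight s h * ENNReal.ofReal ((min 1 ‖R • h‖) ^ (2 * N))) := by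
    intro h
    rw [mul_left_comm (ENNReal.ofReal ((2 * π) ^ (2 * N)))]
    refine mul_le_mul' le_rfl ?_
    rw [← ofReal_norm, ← ENNReal.ofReal_pow (norm_nonneg _), ← ENNReal.ofReal_mul (by positivity),
      ← ENNReal.ofReal_mul (by positivity)]
    refine ENNReal.ofReal_le_ofReal ?_
    have hm1 : min 1 ‖h‖ ≤ min 1 ‖R • h‖ := by
      refine min_le_min_left _ ?_
      rw [norm_smul, Real.norm_eq_abs, abs_of_pos hR0]
      nlinarith [norm_nonneg h]
    have hm2 : ‖(𝐞 (inner ℝ h ξ) : ℂ) - 1‖ ≤ 2 * π * min 1 ‖R • h‖ := by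
      refine (norm_fourierChar_inner_sub_one_le h ξ).trans ?_
      gcongr
      rw [norm_smul, Real.norm_eq_abs, abs_of_pos hR0, mul_comm]
      gcongr
    have hpi : 1 ≤ 2 * π := by nlinarith [Real.pi_gt_three]
    calc (min 1 ‖h‖) ^ (2 * k) * ‖(𝐞 (inner ℝ h ξ) : ℂ) - 1‖ ^ (2 * (N - k))
        ≤ (min 1 ‖R • h‖) ^ (2 * k) * (2 * π * min 1 ‖R • h‖) ^ (2 * (N - k)) := by gcongr
      _ = (2 * π) ^ (2 * (N - k)) * (min 1 ‖R • h‖) ^ (2 * k + 2 * (N - k)) := by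
          rw [mul_pow, pow_add]; ring
      _ ≤ (2 * π) ^ (2 * N) * (min 1 ‖R • h‖) ^ (2 * N) := by
          rw [show 2 * k + 2 * (N - k) = 2 * N by omega]
          gcongr
          omega
  refine (lintegral_mono hpt).trans ?_
  rw [lintegral_const_mul' _ _ ENNReal.ofReal_ne_top,
    lintegral_diffWeight_comp_smul s hR0 (fun h => ENNReal.ofReal ((min 1 ‖h‖) ^ (2 * N))),
    hRs, ENNReal.ofReal_mul (by positivity), ENNReal.ofReal_toReal hJt.ne, ← hJ]
  apply le_of_eq; ring

/-- The symbol of `H^s` is dominated by that of the difference norm. -/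
theorem exists_le_symbol {s : ℝ} (hs : 0 < s) (N : ℕ) :
    ∃ C : ℝ, 0 ≤ C ∧ ∀ ξ : E3, ENNReal.ofReal ((1 + ‖ξ‖ ^ 2) ^ s) ≤
      ENNReal.ofReal C * (1 + ∫⁻ h, diffWeight s h *
        ‖(𝐞 (inner ℝ h ξ) : ℂ) - 1‖ₑ ^ (2 * N)) := by
  set b : ℝ := (volume (Metric.ball (0 : E3) 1)).toReal with hb
  have hbt : volume (Metric.ball (0 : E3) 1) ≠ ⊤ := measure_ball_lt_top.ne
  have hb0 : 0 < b := ENNReal.toReal_pos (Metric.measure_ball_pos _ _ one_pos).ne' hbt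
  set c : ℝ := min 1 (b / 64) with hc
  have hc0 : 0 < c := by positivity
  refine ⟨2 ^ s / c, by positivity, fun ξ => ?_⟩
  set I := ∫⁻ h, diffWeight s h * ‖(𝐞 (inner ℝ h ξ) : ℂ) - 1‖ₑ ^ (2 * N) with hI
  rcases le_or_gt ‖ξ‖ 1 with hξ | hξ
  · calc ENNReal.ofReal ((1 + ‖ξ‖ ^ 2) ^ s) ≤ ENNReal.ofReal (2 ^ s / c) := by
          refine ENNReal.ofReal_le_ofReal ?_
          rw [le_div_iff₀ hc0]
          calc (1 + ‖ξ‖ ^ 2) ^ s * c ≤ 2 ^ s * 1 := by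
                gcongr
                · nlinarith [norm_nonneg ξ]
                · exact min_le_left _ _
            _ = 2 ^ s := mul_one _
      _ ≤ ENNReal.ofReal (2 ^ s / c) * (1 + I) := le_mul_of_one_le_right' (by simp)
  · have hξ0 : 0 < ‖ξ‖ := by linarith
    have hlow : ENNReal.ofReal (b / 64 * ‖ξ‖ ^ (2 * s)) ≤ I := by
      set B := Metric.ball ((1 / (2 * ‖ξ‖ ^ 2)) • ξ) (1 / (4 * ‖ξ‖)) with hB
      have hmem : ∀ h ∈ B, ENNReal.ofReal (‖ξ‖ ^ (3 + 2 * s)) ≤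
          diffWeight s h * ‖(𝐞 (inner ℝ h ξ) : ℂ) - 1‖ₑ ^ (2 * N) := by
        intro h hh
        set h₀ := (1 / (2 * ‖ξ‖ ^ 2)) • ξ with hh0
        have hd : ‖h - h₀‖ < 1 / (4 * ‖ξ‖) := by rwa [hB, mem_ball_iff_norm] at hh
        have hn0 : ‖h₀‖ = 1 / (2 * ‖ξ‖) := by
          rw [hh0, norm_smul, Real.norm_eq_abs, abs_of_pos (by positivity)]
          field_simp
        have hi0 : inner ℝ h₀ ξ = 1 / 2 := by
          rw [hh0, real_inner_smul_left, real_inner_self_eq_norm_sq]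
          field_simp
        have hi1 : |inner ℝ (h - h₀) ξ| ≤ 1 / 4 := by
          refine (abs_real_inner_le_norm _ _).trans ?_
          calc ‖h - h₀‖ * ‖ξ‖ ≤ 1 / (4 * ‖ξ‖) * ‖ξ‖ := by gcongr
            _ = 1 / 4 := by field_simp
        have hi2 : inner ℝ h ξ = 1 / 2 + inner ℝ (h - h₀) ξ := by
          rw [inner_sub_left, hi0]; ring
        have h1 : 1 ≤ ‖(𝐞 (inner ℝ h ξ) : ℂ) - 1‖ := by
          rw [abs_le] at hi1
          exact one_le_norm_fourierChar_sub_one (by linarith) (by linarith)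
        have hup : ‖h‖ ≤ 1 / ‖ξ‖ := by
          have : ‖h‖ ≤ ‖h₀‖ + ‖h - h₀‖ := norm_le_norm_add_norm_sub' h h₀
          have e1 : 1 / (2 * ‖ξ‖) = 1 / 2 * (1 / ‖ξ‖) := by field_simp
          have e2 : 1 / (4 * ‖ξ‖) = 1 / 4 * (1 / ‖ξ‖) := by field_simp
          have : 0 < 1 / ‖ξ‖ := by positivity
          rw [hn0] at *
          linarith
        have hpos : 0 < ‖h‖ := by
          have : ‖h₀‖ ≤ ‖h‖ + ‖h - h₀‖ := norm_le_norm_add_norm_sub h h₀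
          have e1 : 1 / (2 * ‖ξ‖) = 1 / 2 * (1 / ‖ξ‖) := by field_simp
          have e2 : 1 / (4 * ‖ξ‖) = 1 / 4 * (1 / ‖ξ‖) := by field_simp
          have : 0 < 1 / ‖ξ‖ := by positivity
          rw [hn0] at *
          linarith
        have hw : ‖ξ‖ ^ (3 + 2 * s) ≤ ‖h‖ ^ (-(3 + 2 * s)) := by
          calc ‖ξ‖ ^ (3 + 2 * s) = (1 / ‖ξ‖) ^ (-(3 + 2 * s)) := by
                rw [one_div, Real.inv_rpow hξ0.le, ← Real.rpow_neg hξ0.le, neg_neg]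
            _ ≤ _ := Real.rpow_le_rpow_of_nonpos hpos hup (by linarith)
        calc ENNReal.ofReal (‖ξ‖ ^ (3 + 2 * s)) ≤ diffWeight s h :=
              ENNReal.ofReal_le_ofReal hw
          _ ≤ _ := le_mul_of_one_le_right' (one_le_pow₀ (by
              rw [← ofReal_norm]; exact ENNReal.one_le_ofReal.2 h1))
      calc ENNReal.ofReal (b / 64 * ‖ξ‖ ^ (2 * s))
          = ENNReal.ofReal (‖ξ‖ ^ (3 + 2 * s)) * volume B := by
            rw [hB, Measure.addHaar_ball _ _ (by positivity), ← ENNReal.ofReal_toReal hbt, ← hb,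
              ← ENNReal.ofReal_mul (by positivity), ← ENNReal.ofReal_mul (by positivity)]
            congr 1
            rw [Real.rpow_add hξ0, Real.rpow_ofNat]
            have : Module.finrank ℝ E3 = 3 := by simp
            rw [this]
            field_simp
            norm_num
        _ = ∫⁻ _ in B, ENNReal.ofReal (‖ξ‖ ^ (3 + 2 * s)) := by rw [setLIntegral_const]
        _ ≤ ∫⁻ h in B, diffWeight s h * ‖(𝐞 (inner ℝ h ξ) : ℂ) - 1‖ₑ ^ (2 * N) :=
            setLIntegral_mono' Metric.isOpen_ball.measurableSet hmem
        _ ≤ I := setLIntegral_le_lintegral _ _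
    calc ENNReal.ofReal ((1 + ‖ξ‖ ^ 2) ^ s)
        ≤ ENNReal.ofReal (2 ^ s / c * (b / 64 * ‖ξ‖ ^ (2 * s))) := by
          refine ENNReal.ofReal_le_ofReal ?_
          have h1 : (1 + ‖ξ‖ ^ 2) ^ s ≤ (2 * ‖ξ‖ ^ 2) ^ s := by
            gcongr; nlinarith
          have h2 : (2 * ‖ξ‖ ^ 2) ^ s = 2 ^ s * ‖ξ‖ ^ (2 * s) := by
            rw [Real.mul_rpow (by norm_num) (by positivity), Real.rpow_mul hξ0.le, Real.rpow_two]
          rw [h2] at h1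
          refine h1.trans ?_
          have h3 : 1 ≤ b / 64 / c := by rw [one_le_div hc0]; exact min_le_right _ _
          calc 2 ^ s * ‖ξ‖ ^ (2 * s) ≤ 2 ^ s * ‖ξ‖ ^ (2 * s) * (b / 64 / c) :=
                le_mul_of_one_le_right (by positivity) h3
            _ = _ := by ring
      _ = ENNReal.ofReal (2 ^ s / c) * ENNReal.ofReal (b / 64 * ‖ξ‖ ^ (2 * s)) :=
          ENNReal.ofReal_mul (by positivity)
      _ ≤ ENNReal.ofReal (2 ^ s / c) * (1 + I) := by
          gcongr
          exact hlow.trans le_add_self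

/-- The squared difference norm `‖f‖_{L²}² + ∫ |h|^{-3-2s} ‖Δ_h^N f‖_{L²}² dh`, which for
`0 < s < N` is equivalent to the squared `H^s` norm. -/
def diffNormSq {V : Type*} [NormedAddCommGroup V] (s : ℝ) (N : ℕ) (f : E3 → V) : ℝ≥0∞ :=
  (∫⁻ x, ‖f x‖ₑ ^ 2) + ∫⁻ h, diffWeight s h * ∫⁻ x, ‖(fwdDiff h)^[N] f x‖ₑ ^ 2

theorem continuous_fourier_of_integrable {f : E3 → ℂ} (hf : Integrable f) : Continuous (𝓕 f) :=
  VectorFourier.fourierIntegral_continuous continuous_fourierChar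
    (by exact continuous_inner) hf

theorem measurable_enorm_fourierChar_inner_sub_one :
    Measurable fun p : E3 × E3 => ‖(𝐞 (inner ℝ p.1 p.2) : ℂ) - 1‖ₑ := by
  have : Continuous fun p : E3 × E3 => (𝐞 (inner ℝ p.1 p.2) : ℂ) - 1 :=
    (continuous_subtype_val.comp (continuous_fourierChar.comp continuous_inner)).sub continuous_const
  exact this.measurable.enorm

theorem HsNormSq_eq (s : ℝ) (f : E3 → ℂ) :
    HsNormSq s f = ∫⁻ ξ, ENNReal.ofReal ((1 + ‖ξ‖ ^ 2) ^ s) * ‖𝓕 f ξ‖ₑ ^ 2 := rfl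

theorem lintegral_mul_lintegral_mul_swap {a g : E3 → ℝ≥0∞} {e : E3 × E3 → ℝ≥0∞}
    (ha : Measurable a) (hg : Measurable g) (he : Measurable e) :
    ∫⁻ h, a h * ∫⁻ ξ, e (h, ξ) * g ξ = ∫⁻ ξ, (∫⁻ h, a h * e (h, ξ)) * g ξ := by
  calc ∫⁻ h, a h * ∫⁻ ξ, e (h, ξ) * g ξ
      = ∫⁻ h, ∫⁻ ξ, a h * (e (h, ξ) * g ξ) :=
        lintegral_congr fun h => (lintegral_const_mul _ (by fun_prop)).symm
    _ = ∫⁻ ξ, ∫⁻ h, a h * (e (h, ξ) * g ξ) := lintegral_lintegral_swap (by fun_prop)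
    _ = _ := lintegral_congr fun ξ => by
        rw [← lintegral_mul_const _ (by fun_prop)]
        simp only [mul_assoc]

theorem lintegral_diffWeight_mul_fwdDiff (s : ℝ) {f : E3 → ℂ} (hf : Integrable f)
    (hf2 : MemLp f 2) {ρ : E3 → ℝ≥0∞} (hρ : Measurable ρ) (n : ℕ) :
    ∫⁻ h, diffWeight s h * (ρ h * ∫⁻ x, ‖(fwdDiff h)^[n] f x‖ₑ ^ 2) =
      ∫⁻ ξ, (∫⁻ h, diffWeight s h * (ρ h * ‖(𝐞 (inner ℝ h ξ) : ℂ) - 1‖ₑ ^ (2 * n))) *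
        ‖𝓕 f ξ‖ₑ ^ 2 := by
  have hfm : Measurable fun ξ => ‖𝓕 f ξ‖ₑ ^ 2 :=
    (continuous_fourier_of_integrable hf).measurable.enorm.pow_const 2
  have key := lintegral_mul_lintegral_mul_swap (a := fun h => diffWeight s h * ρ h)
    ((measurable_diffWeight s).mul hρ) hfm
    (measurable_enorm_fourierChar_inner_sub_one.pow_const (2 * n))
  simp only [mul_assoc] at key
  rw [← key]
  exact lintegral_congr fun h => by rw [lintegral_fwdDiff_iter_sq hf hf2]

theorem exists_HsNormSq_le_diffNormSq {s : ℝ} (hs : 0 < s) (N : ℕ) :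
    ∃ C : ℝ, 0 ≤ C ∧ ∀ f : E3 → ℂ, Integrable f → MemLp f 2 →
      HsNormSq s f ≤ ENNReal.ofReal C * diffNormSq s N f := by
  obtain ⟨C, hC, h⟩ := exists_le_symbol hs N
  refine ⟨C, hC, fun f hf hf2 => ?_⟩
  have hfm : Measurable fun ξ => ‖𝓕 f ξ‖ₑ ^ 2 :=
    (continuous_fourier_of_integrable hf).measurable.enorm.pow_const 2
  have h2 := lintegral_diffWeight_mul_fwdDiff s hf hf2 (ρ := fun _ => 1) measurable_const N
  simp only [one_mul] at h2
  rw [diffNormSq, h2, ← lintegral_fourier_sq hf hf2, ← lintegral_add_left hfm,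
    ← lintegral_const_mul' _ _ ENNReal.ofReal_ne_top, HsNormSq_eq]
  refine lintegral_mono fun ξ => ?_
  calc _ ≤ ENNReal.ofReal C * (1 + ∫⁻ h, diffWeight s h *
        ‖(𝐞 (inner ℝ h ξ) : ℂ) - 1‖ₑ ^ (2 * N)) * ‖𝓕 f ξ‖ₑ ^ 2 := mul_le_mul' (h ξ) le_rfl
    _ = _ := by ring

theorem exists_lintegral_fwdDiff_le_HsNormSq {s : ℝ} (hs : 0 < s) {N : ℕ} (hN : s < N) :
    ∃ C : ℝ, 0 ≤ C ∧ ∀ f : E3 → ℂ, Integrable f → MemLp f 2 → ∀ k ≤ N,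
      ∫⁻ h, diffWeight s h * (ENNReal.ofReal ((min 1 ‖h‖) ^ (2 * k)) *
        ∫⁻ x, ‖(fwdDiff h)^[N - k] f x‖ₑ ^ 2) ≤ ENNReal.ofReal C * HsNormSq s f := by
  obtain ⟨C, hC, h⟩ := exists_symbol_le hs hN
  refine ⟨C, hC, fun f hf hf2 k hk => ?_⟩
  rw [lintegral_diffWeight_mul_fwdDiff s hf hf2 (by fun_prop), HsNormSq_eq,
    ← lintegral_const_mul' _ _ ENNReal.ofReal_ne_top]
  refine lintegral_mono fun ξ => ?_
  rw [← mul_assoc]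
  exact mul_le_mul' (h ξ k hk) le_rfl

theorem lintegral_sq_le_HsNormSq {s : ℝ} (hs : 0 < s) {f : E3 → ℂ} (hf : Integrable f)
    (hf2 : MemLp f 2) : ∫⁻ x, ‖f x‖ₑ ^ 2 ≤ HsNormSq s f := by
  rw [← lintegral_fourier_sq hf hf2, HsNormSq_eq]
  refine lintegral_mono fun ξ => le_mul_of_one_le_left' ?_
  exact ENNReal.one_le_ofReal.2 (Real.one_le_rpow (by nlinarith [norm_nonneg ξ]) hs.le)

theorem fwdDiff_iter_ofReal (f : E3 → ℝ) (h : E3) (n : ℕ) (x : E3) :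
    (fwdDiff h)^[n] (fun x => (f x : ℂ)) x = (((fwdDiff h)^[n] f x : ℝ) : ℂ) := by
  induction n generalizing x with
  | zero => rfl
  | succ n ih => simp only [Function.iterate_succ_apply', fwdDiff, ih, Complex.ofReal_sub]

theorem enorm_fwdDiff_iter_ofReal (f : E3 → ℝ) (h : E3) (n : ℕ) (x : E3) :
    ‖(fwdDiff h)^[n] (fun x => (f x : ℂ)) x‖ₑ = ‖(fwdDiff h)^[n] f x‖ₑ := by
  rw [fwdDiff_iter_ofReal, ← ofReal_norm, ← ofReal_norm, Complex.norm_real]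

theorem enorm_complex_ofReal (r : ℝ) : ‖(r : ℂ)‖ₑ = ‖r‖ₑ := by
  rw [← ofReal_norm, ← ofReal_norm, Complex.norm_real]

theorem diffNormSq_ofReal (s : ℝ) (N : ℕ) (f : E3 → ℝ) :
    diffNormSq s N (fun x => (f x : ℂ)) = diffNormSq s N f := by
  simp only [diffNormSq, enorm_fwdDiff_iter_ofReal, enorm_complex_ofReal]

theorem exists_diffNormSq_le_HsNormSq {s : ℝ} (hs : 0 < s) {N : ℕ} (hN : s < N) :
    ∃ C : ℝ, 0 ≤ C ∧ ∀ f : E3 → ℂ, Integrable f → MemLp f 2 →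
      diffNormSq s N f ≤ ENNReal.ofReal C * HsNormSq s f := by
  obtain ⟨C, hC, h⟩ := exists_lintegral_fwdDiff_le_HsNormSq hs hN
  refine ⟨1 + C, by positivity, fun f hf hf2 => ?_⟩
  have h0 := h f hf hf2 0 (Nat.zero_le _)
  simp only [mul_zero, pow_zero, ENNReal.ofReal_one, one_mul, Nat.sub_zero] at h0
  rw [diffNormSq, ENNReal.ofReal_add zero_le_one hC, ENNReal.ofReal_one, add_mul, one_mul]
  exact add_le_add (lintegral_sq_le_HsNormSq hs hf hf2) h0

section DiscreteChainRule

variable {E V : Type} [NormedAddCommGroup E] [NormedSpace ℝ E] [NormedAddCommGroup V]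
  [NormedSpace ℝ V]

theorem norm_fwdDiff_iter_clm_apply_le {A B D : ℝ} {n : ℕ} {a : ℕ → E →L[ℝ] V} {b : ℕ → E}
    (hA : 0 ≤ A) (hB : 0 ≤ B) (hD : 0 ≤ D)
    (ha : ∀ k j, j + k ≤ n → ‖(fwdDiff 1)^[k] a j‖ ≤ A * D ^ k)
    (hb : ∀ k j, j + k ≤ n → ‖(fwdDiff 1)^[k] b j‖ ≤ B * D ^ k) (k j : ℕ) (hjk : j + k ≤ n) :
    ‖(fwdDiff 1)^[k] (fun i => a i (b i)) j‖ ≤ 2 ^ k * A * B * D ^ k := by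
  induction k generalizing a b A B n j with
  | zero =>
    have h1 := ha 0 j hjk
    have h2 := hb 0 j hjk
    simp only [Function.iterate_zero, id, pow_zero, mul_one, one_mul] at *
    exact ((a j).le_opNorm _).trans (by gcongr)
  | succ k ih =>
    have hsplit : fwdDiff 1 (fun i => a i (b i)) =
        (fun i => (fwdDiff 1 a i) (b (i + 1))) + fun i => a i (fwdDiff 1 b i) := by
      ext i
      simp [fwdDiff]
    rw [Function.iterate_succ_apply, hsplit, fwdDiff_iter_add, Pi.add_apply]
    have h1 := ih (a := fwdDiff 1 a) (b := fun i => b (i + 1)) (n := n - 1) (A := A * D) (B := B)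
      (by positivity) hB
      (fun k j hkj => by
        rw [← Function.iterate_succ_apply]
        exact (ha (k + 1) j (by omega)).trans_eq (by ring))
      (fun k j hkj => by
        rw [fwdDiff_iter_comp_add]
        exact hb k (j + 1) (by omega)) j (by omega)
    have h2 := ih (a := a) (b := fwdDiff 1 b) (n := n - 1) (A := A) (B := B * D)
      hA (by positivity)
      (fun k j hkj => ha k j (by omega))
      (fun k j hkj => by
        rw [← Function.iterate_succ_apply]
        exact (hb (k + 1) j (by omega)).trans_eq (by ring)) j (by omega)
    calc _ ≤ _ := norm_add_le _ _
      _ ≤ _ := add_le_add h1 h2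
      _ = _ := by ring

theorem hasDerivAt_fwdDiff_iter {g : ℝ → ℕ → V} {g' : ℕ → V} {τ : ℝ}
    (hg : ∀ j, HasDerivAt (fun t => g t j) (g' j) τ) (k j : ℕ) :
    HasDerivAt (fun t => (fwdDiff 1)^[k] (g t) j) ((fwdDiff 1)^[k] g' j) τ := by
  induction k generalizing j with
  | zero => exact hg j
  | succ k ih =>
    simp only [Function.iterate_succ_apply', fwdDiff]
    exact (ih (j + 1)).sub (ih j)

/-- The constants in the discrete chain rule. -/
def chainConst : ℕ → ℝ
  | 0 => 1
  | n + 1 => 2 ^ n * chainConst n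

theorem one_le_chainConst (n : ℕ) : 1 ≤ chainConst n := by
  induction n with
  | zero => exact le_rfl
  | succ n ih => exact one_le_mul_of_one_le_of_one_le (one_le_pow₀ one_le_two) ih

theorem norm_fwdDiff_iter_comp_le (n : ℕ) {V : Type} [NormedAddCommGroup V]
    [NormedSpace ℝ V] {F : E → V} (hF : ContDiff ℝ n F) {K : Set E} (hK : Convex ℝ K) {M D : ℝ}
    (hM : 0 ≤ M) (hD : 0 ≤ D)
    (hFM : ∀ k, 1 ≤ k → k ≤ n → ∀ y ∈ K, ‖iteratedFDeriv ℝ k F y‖ ≤ M)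
    {u : ℕ → E} (huK : ∀ j, u j ∈ K)
    (hu : ∀ k j, 1 ≤ k → j + k ≤ n → ‖(fwdDiff 1)^[k] u j‖ ≤ D ^ k) (k j : ℕ) (hk : 1 ≤ k)
    (hjk : j + k ≤ n) :
    ‖(fwdDiff 1)^[k] (fun i => F (u i)) j‖ ≤ chainConst n * M * D ^ k := by
  induction n generalizing V u k j with
  | zero => omega
  | succ n ih =>
    obtain ⟨k, rfl⟩ : ∃ k', k = k' + 1 := ⟨k - 1, by omega⟩
    have hdiff : ∀ y, HasFDerivAt F (fderiv ℝ F y) y := fun y =>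
      (hF.differentiable (by norm_cast) y).hasFDerivAt
    have hF' : ContDiff ℝ n (fderiv ℝ F) := hF.fderiv_right (by norm_cast)
    set w : ℝ → ℕ → E := fun τ i => u i + τ • (fwdDiff 1 u i) with hw
    have hφ : ∀ τ, HasDerivAt (fun t => (fwdDiff 1)^[k] (fun i => F (w t i)) j)
        ((fwdDiff 1)^[k] (fun i => fderiv ℝ F (w τ i) (fwdDiff 1 u i)) j) τ := by
      intro τ
      refine hasDerivAt_fwdDiff_iter (fun i => ?_) k j
      have : HasDerivAt (fun t => w t i) (fwdDiff 1 u i) τ := by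
        have h := ((hasDerivAt_id τ).smul_const (fwdDiff 1 u i)).const_add (u i)
        rw [one_smul] at h
        exact h
      exact (hdiff _).comp_hasDerivAt τ this
    have hb : ∀ τ ∈ Ico (0:ℝ) 1,
        ‖(fwdDiff 1)^[k] (fun i => fderiv ℝ F (w τ i) (fwdDiff 1 u i)) j‖
          ≤ chainConst (n + 1) * M * D ^ (k + 1) := by
      intro τ hτ
      have hwK : ∀ i, w τ i ∈ K := fun i => by
        have : w τ i = AffineMap.lineMap (u i) (u (i + 1)) τ := by
          simp [hw, fwdDiff, AffineMap.lineMap_apply, add_comm]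
        rw [this]
        exact hK.lineMap_mem (huK i) (huK _) ⟨hτ.1, hτ.2.le⟩
      have hwD : ∀ k j, 1 ≤ k → j + k ≤ n → ‖(fwdDiff 1)^[k] (w τ) j‖ ≤ D ^ k := by
        intro k j hk hjk
        have : w τ = (1 - τ) • u + τ • (fun i => u (i + 1)) := by
          ext i
          simp only [hw, fwdDiff, Pi.add_apply, Pi.smul_apply]
          module
        rw [this, fwdDiff_iter_add, fwdDiff_iter_const_smul, fwdDiff_iter_const_smul,
          Pi.add_apply, Pi.smul_apply, Pi.smul_apply, fwdDiff_iter_comp_add]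
        have h1 := hu k j hk (by omega)
        have h2 := hu k (j + 1) hk (by omega)
        have h3 : 0 ≤ 1 - τ := by linarith [hτ.2]
        calc _ ≤ _ := norm_add_le _ _
          _ = (1 - τ) * ‖(fwdDiff 1)^[k] u j‖ + τ * ‖(fwdDiff 1)^[k] u (j + 1)‖ := by
            rw [norm_smul, norm_smul, Real.norm_of_nonneg h3, Real.norm_of_nonneg hτ.1]
          _ ≤ (1 - τ) * D ^ k + τ * D ^ k :=
            add_le_add (mul_le_mul_of_nonneg_left h1 h3) (mul_le_mul_of_nonneg_left h2 hτ.1)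
          _ = _ := by ring
      have hc := one_le_chainConst n
      have ha : ∀ k j, j + k ≤ n →
          ‖(fwdDiff 1)^[k] (fun i => fderiv ℝ F (w τ i)) j‖ ≤ chainConst n * M * D ^ k := by
        intro k j hjk
        rcases Nat.eq_zero_or_pos k with rfl | hk
        · have := hFM 1 le_rfl (by omega) (w τ j) (hwK j)
          rw [← zero_add 1, ← norm_iteratedFDeriv_fderiv, norm_iteratedFDeriv_zero] at this
          simp only [Function.iterate_zero, id, pow_zero, mul_one]
          nlinarith
        · exact ih hF' (fun k hk hkn y hy => by
            rw [norm_iteratedFDeriv_fderiv]; exact hFM _ (by omega) (by omega) y hy)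
            hwK hwD k j hk hjk
      have := norm_fwdDiff_iter_clm_apply_le (B := D) (by positivity) hD hD ha
        (b := fwdDiff 1 u) (fun k j hjk => by
          rw [← Function.iterate_succ_apply]
          exact (hu (k + 1) j (by omega) (by omega)).trans_eq (by ring)) k j (by omega)
      refine this.trans ?_
      have h2 : (2:ℝ) ^ k ≤ 2 ^ n := pow_le_pow_right₀ one_le_two (by omega)
      calc 2 ^ k * (chainConst n * M) * D * D ^ k
          ≤ 2 ^ n * (chainConst n * M) * D * D ^ k := by gcongr
        _ = _ := by rw [chainConst]; ring
    have := norm_image_sub_le_of_norm_deriv_le_segment_01'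
      (fun τ _ => (hφ τ).hasDerivWithinAt) hb
    convert this using 2
    rw [Function.iterate_succ_apply]
    have h1 : fwdDiff 1 (fun i => F (u i)) = (fun i => F (w 1 i)) + (-1:ℝ) • fun i => F (w 0 i) := by
      ext i
      simp [hw, fwdDiff, sub_eq_add_neg]
    rw [h1, fwdDiff_iter_add, fwdDiff_iter_const_smul]
    simp [sub_eq_add_neg]

theorem fwdDiff_iter_comp_nsmul {M G : Type*} [AddCommMonoid M] [AddCommGroup G] (f : M → G)
    (x h : M) (k j : ℕ) :
    (fwdDiff 1)^[k] (fun i : ℕ => f (x + i • h)) j = (fwdDiff h)^[k] f (x + j • h) := by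
  induction k generalizing j with
  | zero => rfl
  | succ k ih =>
    simp only [Function.iterate_succ_apply', fwdDiff, ih, add_smul, one_smul, add_assoc]

end DiscreteChainRule

section Marchaud

variable {V : Type*} [NormedAddCommGroup V] [NormedSpace ℝ V]

theorem norm_fwdDiff_two_smul_sub_le (w : E3 → V) (h : E3) (m : ℕ) (x : E3) :
    ‖((2:ℝ) ^ m)⁻¹ • (fwdDiff ((2:ℝ) • h))^[m] w x - (fwdDiff h)^[m] w x‖ ≤
      ∑ i ∈ Finset.range m, ‖(fwdDiff h)^[m + 1] w (x + i • h)‖ := by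
  induction m generalizing w x with
  | zero => simp
  | succ m ih =>
    set v : E3 → V := (1 / 2 : ℝ) • ((fun y => fwdDiff h w (y + h)) + fwdDiff h w) with hv
    have hv2 : fwdDiff ((2:ℝ) • h) w = (2:ℝ) • v := by
      ext y
      simp only [hv, fwdDiff, Pi.smul_apply, Pi.add_apply, two_smul, add_assoc]
      module
    have hvk : ∀ k y, (fwdDiff h)^[k] v y =
        (1 / 2 : ℝ) • ((fwdDiff h)^[k + 1] w (y + h) + (fwdDiff h)^[k + 1] w y) := by
      intro k y
      rw [hv, fwdDiff_iter_const_smul, fwdDiff_iter_add, Pi.smul_apply, Pi.add_apply,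
        fwdDiff_iter_comp_add, ← Function.iterate_succ_apply]
    set d : ℕ → ℝ := fun i => ‖(fwdDiff h)^[m + 1 + 1] w (x + i • h)‖ with hd
    have h1 : ((2:ℝ) ^ (m + 1))⁻¹ • (fwdDiff ((2:ℝ) • h))^[m + 1] w x
        - (fwdDiff h)^[m + 1] w x = (((2:ℝ) ^ m)⁻¹ • (fwdDiff ((2:ℝ) • h))^[m] v x
        - (fwdDiff h)^[m] v x) + (1 / 2 : ℝ) • (fwdDiff h)^[m + 1 + 1] w x := by
      rw [Function.iterate_succ_apply (fwdDiff ((2:ℝ) • h)), hv2, fwdDiff_iter_const_smul,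
        Pi.smul_apply, hvk, Function.iterate_succ_apply' _ (m + 1), fwdDiff, smul_smul, pow_succ,
        mul_inv, mul_assoc, inv_mul_cancel₀ two_ne_zero, mul_one]
      module
    have h2 : ∀ i ∈ Finset.range m, ‖(fwdDiff h)^[m + 1] v (x + i • h)‖
        ≤ 1 / 2 * d (i + 1) + 1 / 2 * d i := by
      intro i _
      rw [hvk, norm_smul, Real.norm_of_nonneg (by norm_num), ← mul_add]
      refine mul_le_mul_of_nonneg_left ((norm_add_le _ _).trans_eq ?_) (by norm_num)
      simp only [hd, add_smul, one_smul, add_assoc]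
    have hd0 : 0 ≤ d m := norm_nonneg _
    calc _ ≤ ∑ i ∈ Finset.range m, (1 / 2 * d (i + 1) + 1 / 2 * d i) + 1 / 2 * d 0 := by
          rw [h1]
          refine (norm_add_le _ _).trans (add_le_add ((ih v x).trans (Finset.sum_le_sum h2)) ?_)
          rw [norm_smul, Real.norm_of_nonneg (by norm_num)]
          simp [hd]
      _ ≤ ∑ i ∈ Finset.range (m + 1), d i := by
          rw [Finset.sum_add_distrib, ← Finset.mul_sum, ← Finset.mul_sum]
          have e1 := Finset.sum_range_succ d m
          have e2 := Finset.sum_range_succ' d m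
          linarith

theorem enorm_fwdDiff_iter_le_two_smul (w : E3 → V) (h : E3) (k : ℕ) (x : E3) :
    ‖(fwdDiff h)^[k] w x‖ₑ ≤ ENNReal.ofReal ((2:ℝ) ^ k)⁻¹ * ‖(fwdDiff ((2:ℝ) • h))^[k] w x‖ₑ +
      ∑ i ∈ Finset.range k, ‖(fwdDiff h)^[k + 1] w (x + i • h)‖ₑ := by
  have h1 := norm_fwdDiff_two_smul_sub_le w h k x
  have h2 : ‖(fwdDiff h)^[k] w x‖ ≤ ((2:ℝ) ^ k)⁻¹ * ‖(fwdDiff ((2:ℝ) • h))^[k] w x‖ +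
      ∑ i ∈ Finset.range k, ‖(fwdDiff h)^[k + 1] w (x + i • h)‖ := by
    have h3 := norm_sub_norm_le ((fwdDiff h)^[k] w x)
      (((2:ℝ) ^ k)⁻¹ • (fwdDiff ((2:ℝ) • h))^[k] w x)
    rw [norm_sub_rev, norm_smul, Real.norm_of_nonneg (by positivity)] at h3
    linarith
  simp only [← ofReal_norm]
  rw [← ENNReal.ofReal_mul (by positivity), ← ENNReal.ofReal_sum_of_nonneg (fun _ _ => norm_nonneg _),
    ← ENNReal.ofReal_add (by positivity) (by positivity)]
  exact ENNReal.ofReal_le_ofReal h2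

theorem norm_fwdDiff_iter_le {M W : Type*} [AddCommMonoid M] [NormedAddCommGroup W]
    {w : M → W} {B : ℝ}
    (hw : ∀ x, ‖w x‖ ≤ B) (h : M) (k : ℕ) (x : M) :
    ‖(fwdDiff h)^[k] w x‖ ≤ 2 ^ k * B := by
  induction k generalizing x with
  | zero => simpa using hw x
  | succ k ih =>
    rw [Function.iterate_succ_apply', fwdDiff]
    calc _ ≤ _ := norm_sub_le _ _
      _ ≤ 2 ^ k * B + 2 ^ k * B := add_le_add (ih _) (ih _)
      _ = _ := by ring

theorem stronglyMeasurable_fwdDiff_iter {W : Type*} [NormedAddCommGroup W] {w : E3 → W}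
    (hw : StronglyMeasurable w) (k : ℕ) :
    StronglyMeasurable fun p : E3 × E3 => (fwdDiff p.1)^[k] w p.2 := by
  induction k with
  | zero => exact hw.comp_measurable measurable_snd
  | succ k ih =>
    simp only [Function.iterate_succ_apply', fwdDiff]
    exact (ih.comp_measurable
      (measurable_fst.prodMk (measurable_snd.add measurable_fst))).sub ih

theorem add_rpow_le_of_pos (a b : ℝ≥0∞) {ε p : ℝ} (hε : 0 < ε) (hp : 0 ≤ p) :
    (a + b) ^ p ≤ ENNReal.ofReal ((1 + ε) ^ p) * a ^ p +
      ENNReal.ofReal ((1 + ε⁻¹) ^ p) * b ^ p := by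
  rcases le_total b (ENNReal.ofReal ε * a) with hb | hb
  · refine le_trans ?_ le_self_add
    rw [← ENNReal.ofReal_rpow_of_pos (by positivity), ← ENNReal.mul_rpow_of_nonneg _ _ hp]
    refine ENNReal.rpow_le_rpow ?_ hp
    rw [ENNReal.ofReal_add zero_le_one hε.le, add_mul, ENNReal.ofReal_one, one_mul]
    gcongr
  · refine le_trans ?_ le_add_self
    rw [← ENNReal.ofReal_rpow_of_pos (by positivity), ← ENNReal.mul_rpow_of_nonneg _ _ hp]
    refine ENNReal.rpow_le_rpow ?_ hp
    have : a ≤ ENNReal.ofReal ε⁻¹ * b := by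
      calc a = ENNReal.ofReal ε⁻¹ * (ENNReal.ofReal ε * a) := by
            rw [← mul_assoc, ← ENNReal.ofReal_mul (by positivity), inv_mul_cancel₀ hε.ne',
              ENNReal.ofReal_one, one_mul]
        _ ≤ _ := by gcongr
    rw [ENNReal.ofReal_add zero_le_one (by positivity), add_mul, ENNReal.ofReal_one, one_mul,
      add_comm]
    gcongr

theorem rpow_le_mul_rpow_of_le {a R : ℝ≥0∞} {p q : ℝ} (ha : a ≤ R) (hq : 0 ≤ q) (hqp : q ≤ p) :
    a ^ p ≤ R ^ (p - q) * a ^ q := by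
  have : a ^ p = a ^ (p - q) * a ^ q := by
    rw [← ENNReal.rpow_add_of_nonneg _ _ (sub_nonneg.2 hqp) hq, sub_add_cancel]
  rw [this]
  gcongr

theorem lintegral_fwdDiff_iter_sq_le {V : Type*} [NormedAddCommGroup V] {w : E3 → V}
    (hw : StronglyMeasurable w) (h : E3) (k : ℕ) :
    ∫⁻ x, ‖(fwdDiff h)^[k] w x‖ₑ ^ 2 ≤ 4 ^ k * ∫⁻ x, ‖w x‖ₑ ^ 2 := by
  induction k with
  | zero => simp
  | succ k ih =>
    set g := (fwdDiff h)^[k] w with hg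
    have hgm : StronglyMeasurable g :=
      (stronglyMeasurable_fwdDiff_iter hw k).comp_measurable measurable_prodMk_left
    have hgm' : Measurable fun x => ‖g x‖ₑ ^ 2 := hgm.enorm.pow_const 2
    have h1 : ∀ x, ‖(fwdDiff h)^[k + 1] w x‖ₑ ^ 2 ≤ 2 * ‖g (x + h)‖ₑ ^ 2 + 2 * ‖g x‖ₑ ^ 2 := by
      intro x
      rw [Function.iterate_succ_apply', fwdDiff, ← mul_add]
      calc _ ≤ (‖g (x + h)‖ₑ + ‖g x‖ₑ) ^ 2 := by gcongr; exact enorm_sub_le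
        _ ≤ _ := by
          have := ENNReal.rpow_add_le_mul_rpow_add_rpow ‖g (x + h)‖ₑ ‖g x‖ₑ one_le_two
          norm_num at this
          exact_mod_cast this
    calc _ ≤ ∫⁻ x, (2 * ‖g (x + h)‖ₑ ^ 2 + 2 * ‖g x‖ₑ ^ 2) := lintegral_mono h1
      _ = 2 * (∫⁻ x, ‖g x‖ₑ ^ 2) + 2 * ∫⁻ x, ‖g x‖ₑ ^ 2 := by
        rw [lintegral_add_right _ (hgm'.const_mul 2), lintegral_const_mul' _ _ (by simp),
          lintegral_const_mul' _ _ (by simp),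
          lintegral_add_right_eq_self (fun x => ‖g x‖ₑ ^ 2) h]
      _ ≤ 2 * (4 ^ k * ∫⁻ x, ‖w x‖ₑ ^ 2) + 2 * (4 ^ k * ∫⁻ x, ‖w x‖ₑ ^ 2) := by gcongr
      _ = _ := by ring

theorem rpow_sum_le_card_rpow_mul {ι : Type*} (t : Finset ι) (a : ι → ℝ≥0∞) {p : ℝ} (hp : 0 < p) :
    (∑ i ∈ t, a i) ^ p ≤ (t.card : ℝ≥0∞) ^ p * ∑ i ∈ t, a i ^ p := by
  have h : ∑ i ∈ t, a i ≤ (t.card : ℝ≥0∞) * (∑ i ∈ t, a i ^ p) ^ p⁻¹ := by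
    rw [← nsmul_eq_mul]
    refine Finset.sum_le_card_nsmul _ _ _ fun i hi => ?_
    rw [ENNReal.le_rpow_inv_iff hp]
    exact Finset.single_le_sum (f := fun i => a i ^ p) (fun _ _ => zero_le) hi
  refine (ENNReal.rpow_le_rpow h hp.le).trans_eq ?_
  rw [ENNReal.mul_rpow_of_nonneg _ _ hp.le, ENNReal.rpow_inv_rpow hp.ne']

theorem le_ofReal_mul_of_le_add {X Y : ℝ≥0∞} {q : ℝ} (hq0 : 0 ≤ q) (hq : q < 1) (hX : X ≠ ⊤)
    (h : X ≤ ENNReal.ofReal q * X + Y) : X ≤ ENNReal.ofReal (1 - q)⁻¹ * Y := by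
  have h1 : ENNReal.ofReal q * X + ENNReal.ofReal (1 - q) * X = X := by
    rw [← add_mul, ← ENNReal.ofReal_add hq0 (by linarith), add_sub_cancel, ENNReal.ofReal_one,
      one_mul]
  have h2 : ENNReal.ofReal (1 - q) * X ≤ Y := by
    rw [← h1] at h
    exact (ENNReal.add_le_add_iff_left (ENNReal.mul_ne_top ENNReal.ofReal_ne_top hX)).1
      (by rwa [h1] at h ⊢)
  calc X = ENNReal.ofReal (1 - q)⁻¹ * (ENNReal.ofReal (1 - q) * X) := by
        rw [← mul_assoc, ← ENNReal.ofReal_mul (inv_nonneg.2 (by linarith)),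
          inv_mul_cancel₀ (by linarith), ENNReal.ofReal_one, one_mul]
    _ ≤ _ := by gcongr

theorem measurable_lintegral_fwdDiff_iter_rpow {V : Type*} [NormedAddCommGroup V] {w : E3 → V}
    (hw : StronglyMeasurable w) (k : ℕ)
    (p : ℝ) : Measurable fun h => ∫⁻ x, ‖(fwdDiff h)^[k] w x‖ₑ ^ p :=
  ((stronglyMeasurable_fwdDiff_iter hw k).enorm.pow_const p).lintegral_prod_right'

theorem lintegral_diffWeight_mul_le_of_far_le {s : ℝ} {I : E3 → ℝ≥0∞} {Y : ℝ≥0∞}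
    (h : ∀ η : ℝ, 0 < η → ∫⁻ h, diffWeight s h * {h : E3 | η < ‖h‖}.indicator I h ≤ Y) :
    ∫⁻ h, diffWeight s h * I h ≤ Y := by
  set t : ℕ → Set E3 := fun n => {h : E3 | ((n:ℝ) + 1)⁻¹ < ‖h‖} with ht
  have hU : (⋃ n, t n) = {(0:E3)}ᶜ := by
    ext x
    simp only [ht, mem_iUnion, mem_ofPred_eq, mem_compl_iff, mem_singleton_iff]
    constructor
    · rintro ⟨n, hn⟩ rfl
      rw [norm_zero] at hn
      exact absurd hn (not_lt.2 (by positivity))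
    · intro hx
      obtain ⟨n, hn⟩ := exists_nat_one_div_lt (norm_pos_iff.2 hx)
      exact ⟨n, by simpa using hn⟩
  have hdir : Directed (· ⊆ ·) t := by
    refine Monotone.directed_le fun m n hmn x hx => ?_
    simp only [ht, mem_ofPred_eq] at hx ⊢
    refine lt_of_le_of_lt ?_ hx
    gcongr
  have htm : ∀ n, MeasurableSet (t n) := fun n => measurableSet_lt measurable_const measurable_norm
  rw [← setLIntegral_univ, ← setLIntegral_congr
      (ae_eq_univ.2 (by rw [compl_compl]; exact measure_singleton (0:E3)) : ({0}ᶜ : Set E3) =ᵐ[volume] univ), ← hU,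
    setLIntegral_iUnion_of_directed _ hdir]
  refine iSup_le fun n => ?_
  rw [← lintegral_indicator (htm n)]
  refine le_trans (lintegral_mono fun x => ?_) (h ((n:ℝ) + 1)⁻¹ (by positivity))
  by_cases hx : x ∈ t n
  · rw [indicator_of_mem hx, indicator_of_mem hx]
  · rw [indicator_of_notMem hx]
    exact zero_le

theorem lintegral_fwdDiff_iter_rpow_le_sq {V : Type*} [NormedAddCommGroup V] {w : E3 → V}
    (hw : StronglyMeasurable w)
    (hw1 : ∀ x, ‖w x‖ ≤ 1) (k : ℕ) {p : ℝ} (hp : 2 ≤ p) (h : E3) :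
    ∫⁻ x, ‖(fwdDiff h)^[k] w x‖ₑ ^ p ≤
      (ENNReal.ofReal (2 ^ k)) ^ (p - 2) * (4 ^ k * ∫⁻ x, ‖w x‖ₑ ^ 2) := by
  have hb : ∀ x, ‖(fwdDiff h)^[k] w x‖ₑ ^ p ≤
      (ENNReal.ofReal (2 ^ k)) ^ (p - 2) * ‖(fwdDiff h)^[k] w x‖ₑ ^ 2 := fun x => by
    rw [← ENNReal.rpow_two]
    refine rpow_le_mul_rpow_of_le ?_ (by norm_num) hp
    rw [← ofReal_norm]
    exact ENNReal.ofReal_le_ofReal (by simpa using norm_fwdDiff_iter_le hw1 h k x)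
  refine (lintegral_mono hb).trans ?_
  rw [lintegral_const_mul' _ _
    (ENNReal.rpow_ne_top_of_nonneg (by linarith) ENNReal.ofReal_ne_top)]
  gcongr
  exact lintegral_fwdDiff_iter_sq_le hw h k

theorem lintegral_far_fwdDiff_iter_lt_top {V : Type*} [NormedAddCommGroup V] {s : ℝ}
    (hs : 0 < s) {w : E3 → V}
    (hw : StronglyMeasurable w) (hw1 : ∀ x, ‖w x‖ ≤ 1) (hw2 : ∫⁻ x, ‖w x‖ₑ ^ 2 < ⊤) (k : ℕ)
    {p : ℝ} (hp : 2 ≤ p) {η : ℝ} (hη : 0 < η) :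
    ∫⁻ h, diffWeight s h * {h : E3 | η < ‖h‖}.indicator
      (fun h => ∫⁻ x, ‖(fwdDiff h)^[k] w x‖ₑ ^ p) h < ⊤ := by
  set B : ℝ≥0∞ := (ENNReal.ofReal (2 ^ k)) ^ (p - 2) * (4 ^ k * ∫⁻ x, ‖w x‖ₑ ^ 2) with hB
  have hBt : B ≠ ⊤ := ENNReal.mul_ne_top
    (ENNReal.rpow_ne_top_of_nonneg (by linarith) ENNReal.ofReal_ne_top)
    (ENNReal.mul_ne_top (by simp) hw2.ne)
  calc _ ≤ ∫⁻ h, B * (diffWeight s h * (Ioi η).indicator 1 ‖h‖) := by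
        refine lintegral_mono fun h => ?_
        by_cases hh : η < ‖h‖
        · rw [indicator_of_mem (by exact hh), indicator_of_mem (by exact hh), Pi.one_apply,
            mul_one, mul_comm B]
          gcongr
          exact lintegral_fwdDiff_iter_rpow_le_sq hw hw1 k hp h
        · rw [indicator_of_notMem (by exact hh)]
          simp
    _ < ⊤ := by
        rw [lintegral_const_mul' _ _ hBt]
        exact ENNReal.mul_lt_top hBt.lt_top (lintegral_diffWeight_far_lt_top hs hη)

theorem exists_lintegral_fwdDiff_iter_rpow_le (V : Type*) [NormedAddCommGroup V] [NormedSpace ℝ V]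
    (k : ℕ) {p q ε : ℝ} (hp : 0 < p) (hq : 0 ≤ q) (hqp : q ≤ p) (hε : 0 < ε) :
    ∃ C : ℝ, 0 ≤ C ∧ ∀ w : E3 → V, StronglyMeasurable w → (∀ x, ‖w x‖ ≤ 1) → ∀ h : E3,
      ∫⁻ x, ‖(fwdDiff h)^[k] w x‖ₑ ^ p ≤ ENNReal.ofReal ((1 + ε) ^ p * (((2:ℝ) ^ k)⁻¹) ^ p) *
          (∫⁻ x, ‖(fwdDiff ((2:ℝ) • h))^[k] w x‖ₑ ^ p) +
        ENNReal.ofReal C * ∫⁻ x, ‖(fwdDiff h)^[k + 1] w x‖ₑ ^ q := by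
  refine ⟨(1 + ε⁻¹) ^ p * ((k:ℝ) ^ p * ((2 ^ (k + 1)) ^ (p - q) * k)), by positivity,
    fun w hw hw1 h => ?_⟩
  set R : ℝ≥0∞ := ENNReal.ofReal (2 ^ (k + 1)) ^ (p - q) with hR
  have hm : ∀ (h : E3) (n : ℕ) (r : ℝ), Measurable fun x => ‖(fwdDiff h)^[n] w x‖ₑ ^ r :=
    fun h n r => ((stronglyMeasurable_fwdDiff_iter hw n).comp_measurable
      measurable_prodMk_left).enorm.pow_const r
  have hpt : ∀ x, ‖(fwdDiff h)^[k] w x‖ₑ ^ p ≤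
      ENNReal.ofReal ((1 + ε) ^ p * (((2:ℝ) ^ k)⁻¹) ^ p) *
        ‖(fwdDiff ((2:ℝ) • h))^[k] w x‖ₑ ^ p +
      ENNReal.ofReal ((1 + ε⁻¹) ^ p) * ((k : ℝ≥0∞) ^ p * (R *
        ∑ i ∈ Finset.range k, ‖(fwdDiff h)^[k + 1] w (x + i • h)‖ₑ ^ q)) := by
    intro x
    refine (ENNReal.rpow_le_rpow (enorm_fwdDiff_iter_le_two_smul w h k x) hp.le).trans ?_
    refine (add_rpow_le_of_pos _ _ hε hp.le).trans (add_le_add (le_of_eq ?_) ?_)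
    · rw [ENNReal.mul_rpow_of_nonneg _ _ hp.le, ENNReal.ofReal_rpow_of_pos (by positivity),
        ← mul_assoc, ← ENNReal.ofReal_mul (by positivity)]
    · gcongr
      refine (rpow_sum_le_card_rpow_mul _ _ hp).trans ?_
      rw [Finset.card_range, Finset.mul_sum _ _ R]
      refine mul_le_mul' le_rfl (Finset.sum_le_sum fun i _ => ?_)
      refine rpow_le_mul_rpow_of_le ?_ hq hqp
      rw [← ofReal_norm]
      exact ENNReal.ofReal_le_ofReal (by simpa using norm_fwdDiff_iter_le hw1 h (k + 1) _)
  refine (lintegral_mono hpt).trans ?_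
  have hRt : R ≠ ⊤ := ENNReal.rpow_ne_top_of_nonneg (by linarith) ENNReal.ofReal_ne_top
  have hkt : (k : ℝ≥0∞) ^ p ≠ ⊤ := ENNReal.rpow_ne_top_of_nonneg hp.le (by simp)
  rw [lintegral_add_left ((hm _ _ _).const_mul _), lintegral_const_mul' _ _ ENNReal.ofReal_ne_top,
    lintegral_const_mul' _ _ ENNReal.ofReal_ne_top, lintegral_const_mul' _ _ hkt,
    lintegral_const_mul' _ _ hRt,
    lintegral_finsetSum _ (f := fun i x => ‖(fwdDiff h)^[k + 1] w (x + i • h)‖ₑ ^ q)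
      (fun i _ => (hm h (k + 1) q).comp (measurable_add_const _))]
  have htr : ∀ i : ℕ, ∫⁻ x, ‖(fwdDiff h)^[k + 1] w (x + i • h)‖ₑ ^ q =
      ∫⁻ x, ‖(fwdDiff h)^[k + 1] w x‖ₑ ^ q := fun i =>
    lintegral_add_right_eq_self (fun x => ‖(fwdDiff h)^[k + 1] w x‖ₑ ^ q) (i • h)
  simp only [htr, Finset.sum_const, Finset.card_range, nsmul_eq_mul]
  refine add_le_add le_rfl (le_of_eq ?_)
  rw [ENNReal.ofReal_mul (by positivity), ENNReal.ofReal_mul (by positivity),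
    ENNReal.ofReal_mul (by positivity), ENNReal.ofReal_natCast,
    ← ENNReal.ofReal_rpow_of_pos (by positivity), ← ENNReal.ofReal_rpow_of_nonneg (by positivity) hp.le,
    ← ENNReal.ofReal_rpow_of_pos (by positivity), ENNReal.ofReal_natCast]
  ring

theorem exists_gagliardo_nirenberg_step (V : Type*) [NormedAddCommGroup V] [NormedSpace ℝ V]
    {s : ℝ} (hs : 0 < s) {N k : ℕ} (hN : s < N) (hk : 1 ≤ k) (hkN : k < N) :
    ∃ C : ℝ, 0 ≤ C ∧ ∀ w : E3 → V, StronglyMeasurable w → (∀ x, ‖w x‖ ≤ 1) →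
      ∫⁻ x, ‖w x‖ₑ ^ 2 < ⊤ →
      ∫⁻ h, diffWeight s h * ∫⁻ x, ‖(fwdDiff h)^[k] w x‖ₑ ^ (2 * N / k : ℝ) ≤
        ENNReal.ofReal C * ∫⁻ h, diffWeight s h *
          ∫⁻ x, ‖(fwdDiff h)^[k + 1] w x‖ₑ ^ (2 * N / (k + 1 : ℕ) : ℝ) := by
  have hk0 : (0:ℝ) < k := by exact_mod_cast hk
  have hkN' : (k:ℝ) < N := by exact_mod_cast hkN
  have hN0 : (0:ℝ) < N := hk0.trans hkN'
  set p : ℝ := 2 * N / k with hp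
  set r : ℝ := 2 * N / (k + 1 : ℕ) with hr
  have hp2 : 2 ≤ p := by rw [hp, le_div_iff₀ hk0]; linarith
  have hp0 : 0 < p := by linarith
  have hrp : r ≤ p := by rw [hr, hp]; gcongr; simp
  have hr0 : 0 ≤ r := by positivity
  have hb1 : (1:ℝ) < 2 ^ ((N - s) / p) :=
    Real.one_lt_rpow one_lt_two (div_pos (by linarith) hp0)
  obtain ⟨C, hC, hstep⟩ := exists_lintegral_fwdDiff_iter_rpow_le V k hp0 hr0 hrp
    (sub_pos.2 hb1)
  have hq1 : (2:ℝ) ^ (s - N) < 1 := Real.rpow_lt_one_of_one_lt_of_neg one_lt_two (by linarith)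
  have hconst : (1 + ((2:ℝ) ^ ((N - s) / p) - 1)) ^ p * (((2:ℝ) ^ k)⁻¹) ^ p * 2 ^ (2 * s) =
      2 ^ (s - N) := by
    rw [add_sub_cancel, ← Real.rpow_mul two_pos.le, div_mul_cancel₀ _ hp0.ne',
      ← Real.rpow_natCast, ← Real.rpow_neg two_pos.le, ← Real.rpow_mul two_pos.le,
      ← Real.rpow_add two_pos, ← Real.rpow_add two_pos]
    congr 1
    rw [hp]
    field_simp
    ring
  refine ⟨(1 - 2 ^ (s - N))⁻¹ * C, mul_nonneg (inv_nonneg.2 (by linarith)) hC,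
    fun w hw hw1 hw2 => ?_⟩
  set Y := ∫⁻ h, diffWeight s h * ∫⁻ x, ‖(fwdDiff h)^[k + 1] w x‖ₑ ^ r with hY
  set I : E3 → ℝ≥0∞ := fun h => ∫⁻ x, ‖(fwdDiff h)^[k] w x‖ₑ ^ p with hI
  refine lintegral_diffWeight_mul_le_of_far_le fun η hη => ?_
  rw [ENNReal.ofReal_mul (inv_nonneg.2 (by linarith)), mul_assoc]
  refine le_ofReal_mul_of_le_add (by positivity) hq1
    (lintegral_far_fwdDiff_iter_lt_top hs hw hw1 hw2 k hp2 hη).ne ?_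
  rw [← hconst, ENNReal.ofReal_mul (by positivity), mul_assoc,
    ← lintegral_diffWeight_comp_smul s two_pos, ← lintegral_const_mul' _ _ ENNReal.ofReal_ne_top,
    ← lintegral_const_mul' _ _ ENNReal.ofReal_ne_top]
  have hIr : Measurable fun h => ENNReal.ofReal C * (diffWeight s h *
      ∫⁻ x, ‖(fwdDiff h)^[k + 1] w x‖ₑ ^ r) :=
    ((measurable_diffWeight s).mul (measurable_lintegral_fwdDiff_iter_rpow hw (k + 1) r)).const_mul _
  rw [← lintegral_add_right _ hIr]
  refine lintegral_mono fun h => ?_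
  by_cases hh : η < ‖h‖
  · have hh2 : η < ‖(2:ℝ) • h‖ := by
      rw [norm_smul, Real.norm_of_nonneg two_pos.le]
      linarith
    rw [indicator_of_mem (by exact hh), indicator_of_mem (by exact hh2)]
    calc _ ≤ diffWeight s h * _ := mul_le_mul' le_rfl (hstep w hw hw1 h)
      _ = _ := by ring
  · rw [indicator_of_notMem (by exact hh), mul_zero]
    exact zero_le

theorem exists_gagliardo_nirenberg (V : Type*) [NormedAddCommGroup V] [NormedSpace ℝ V]
    {s : ℝ} (hs : 0 < s) {N : ℕ} (hN : s < N) :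
    ∃ C : ℝ, 0 ≤ C ∧ ∀ w : E3 → V, StronglyMeasurable w → (∀ x, ‖w x‖ ≤ 1) →
      ∫⁻ x, ‖w x‖ₑ ^ 2 < ⊤ → ∀ k, 1 ≤ k → k ≤ N →
      ∫⁻ h, diffWeight s h * ∫⁻ x, ‖(fwdDiff h)^[k] w x‖ₑ ^ (2 * N / k : ℝ) ≤
        ENNReal.ofReal C * ∫⁻ h, diffWeight s h * ∫⁻ x, ‖(fwdDiff h)^[N] w x‖ₑ ^ 2 := by
  have hN0 : (0:ℝ) < N := hs.trans hN
  have key : ∀ j < N, ∃ C : ℝ, 0 ≤ C ∧ ∀ w : E3 → V, StronglyMeasurable w → (∀ x, ‖w x‖ ≤ 1) →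
      ∫⁻ x, ‖w x‖ₑ ^ 2 < ⊤ →
      ∫⁻ h, diffWeight s h * ∫⁻ x, ‖(fwdDiff h)^[N - j] w x‖ₑ ^ (2 * N / (N - j : ℕ) : ℝ) ≤
        ENNReal.ofReal C * ∫⁻ h, diffWeight s h * ∫⁻ x, ‖(fwdDiff h)^[N] w x‖ₑ ^ 2 := by
    intro j
    induction j with
    | zero =>
      intro _
      refine ⟨1, zero_le_one, fun w _ _ _ => le_of_eq ?_⟩
      simp only [Nat.sub_zero, ENNReal.ofReal_one, one_mul]
      rw [mul_div_assoc, div_self hN0.ne', mul_one]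
      simp only [ENNReal.rpow_two]
    | succ j ih =>
      intro hj
      obtain ⟨C, hC, h⟩ := ih (by omega)
      obtain ⟨C', hC', h'⟩ := exists_gagliardo_nirenberg_step V hs hN (k := N - (j + 1))
        (by omega) (by omega)
      refine ⟨C' * C, by positivity, fun w hw hw1 hw2 => (h' w hw hw1 hw2).trans ?_⟩
      rw [ENNReal.ofReal_mul hC', mul_assoc]
      gcongr
      rw [show N - (j + 1) + 1 = N - j by omega]
      exact h w hw hw1 hw2
  choose! C hC h using key
  refine ⟨∑ j ∈ Finset.range N, C j, Finset.sum_nonneg fun j hj => hC j (Finset.mem_range.1 hj),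
    fun w hw hw1 hw2 k hk hkN => ?_⟩
  have := h (N - k) (by omega) w hw hw1 hw2
  rw [show N - (N - k) = k by omega] at this
  refine this.trans ?_
  gcongr
  exact Finset.single_le_sum (f := C) (fun j hj => hC j (Finset.mem_range.1 hj))
    (Finset.mem_range.2 (by omega))

end Marchaud

section MoserUnweighted

variable {E V : Type} [NormedAddCommGroup E] [NormedSpace ℝ E] [NormedAddCommGroup V]
  [NormedSpace ℝ V]

theorem norm_comp_le_of_norm_iteratedFDeriv_le {n : ℕ} (hn : 1 ≤ n) {G : E → V}
    (hG : ContDiff ℝ n G) (hG0 : G 0 = 0) {B : ℝ}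
    (hGB : ∀ y, ‖y‖ ≤ 1 → ‖iteratedFDeriv ℝ 1 G y‖ ≤ B) {y : E} (hy : ‖y‖ ≤ 1) :
    ‖G y‖ ≤ B * ‖y‖ := by
  have hd : Differentiable ℝ G := hG.differentiable (by exact_mod_cast (by omega : n ≠ 0))
  have := (convex_closedBall (0:E) 1).norm_image_sub_le_of_norm_fderiv_le (𝕜 := ℝ) (f := G) (C := B)
    (fun x _ => hd x) (fun x hx => by
      have := hGB x (by simpa using hx)
      rwa [← zero_add 1, ← norm_iteratedFDeriv_fderiv, norm_iteratedFDeriv_zero] at this)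
    (x := 0) (y := y) (by simp) (by simpa using hy)
  simpa [hG0] using this

theorem enorm_fwdDiff_iter_comp_sq_le {N : ℕ} (hN : 1 ≤ N) {G : E → V} (hG : ContDiff ℝ N G)
    {B : ℝ} (hB : 0 ≤ B) (hGB : ∀ k, 1 ≤ k → k ≤ N → ∀ y, ‖y‖ ≤ 1 → ‖iteratedFDeriv ℝ k G y‖ ≤ B)
    {w : E3 → E} (hw : ∀ x, ‖w x‖ ≤ 1) (h x : E3) :
    ‖(fwdDiff h)^[N] (fun z => G (w z)) x‖ₑ ^ 2 ≤
      ENNReal.ofReal ((chainConst N * B) ^ 2 * (N * (N + 1) : ℕ) ^ (2 * N)) *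
        ∑ t ∈ Finset.Icc 1 N ×ˢ Finset.range (N + 1),
          ‖(fwdDiff h)^[t.1] w (x + t.2 • h)‖ₑ ^ (2 * N / t.1 : ℝ) := by
  set T := Finset.Icc 1 N ×ˢ Finset.range (N + 1) with hT
  set D : ℝ := ∑ t ∈ T, ‖(fwdDiff h)^[t.1] w (x + t.2 • h)‖ ^ (t.1 : ℝ)⁻¹ with hDdef
  have hD : 0 ≤ D := Finset.sum_nonneg fun _ _ => by positivity
  have hc : 0 ≤ chainConst N := zero_le_one.trans (one_le_chainConst N)
  have hchain := norm_fwdDiff_iter_comp_le N hG (convex_closedBall (0:E) 1) hB hD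
    (fun k h1 h2 y hy => hGB k h1 h2 y (by simpa using hy)) (u := fun i => w (x + i • h))
    (fun j => by simpa using hw _)
    (fun k j hk hjk => by
      rw [fwdDiff_iter_comp_nsmul]
      have hk0 : (0:ℝ) < k := by exact_mod_cast hk
      have h1 : ‖(fwdDiff h)^[k] w (x + j • h)‖ ^ (k : ℝ)⁻¹ ≤ D :=
        Finset.single_le_sum (f := fun t : ℕ × ℕ =>
          ‖(fwdDiff h)^[t.1] w (x + t.2 • h)‖ ^ (t.1 : ℝ)⁻¹) (fun _ _ => by positivity)
          (show (k, j) ∈ T by simp only [hT, Finset.mem_product, Finset.mem_Icc,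
            Finset.mem_range]; omega)
      calc _ = (‖(fwdDiff h)^[k] w (x + j • h)‖ ^ (k : ℝ)⁻¹) ^ k := by
            rw [← Real.rpow_natCast, ← Real.rpow_mul (norm_nonneg _), inv_mul_cancel₀ hk0.ne',
              Real.rpow_one]
        _ ≤ _ := by gcongr) N 0 hN (by omega)
  rw [fwdDiff_iter_comp_nsmul (fun z => G (w z)), zero_smul, add_zero] at hchain
  have hN0 : (0:ℝ) < 2 * N := by positivity
  have hDe : ENNReal.ofReal D = ∑ t ∈ T, ‖(fwdDiff h)^[t.1] w (x + t.2 • h)‖ₑ ^ (t.1 : ℝ)⁻¹ := by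
    rw [hDdef, ENNReal.ofReal_sum_of_nonneg (fun _ _ => by positivity)]
    refine Finset.sum_congr rfl fun t _ => ?_
    rw [← ofReal_norm, ENNReal.ofReal_rpow_of_nonneg (norm_nonneg _) (by positivity)]
  have hcard : T.card = N * (N + 1) := by simp [hT]
  calc _ ≤ ENNReal.ofReal (chainConst N * B * D ^ N) ^ 2 := by
        rw [← ofReal_norm]; gcongr
    _ = ENNReal.ofReal ((chainConst N * B) ^ 2) * ENNReal.ofReal D ^ (2 * N : ℝ) := by
        rw [← ENNReal.ofReal_pow (by positivity), mul_pow, ENNReal.ofReal_mul (by positivity),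
          ← pow_mul, ENNReal.ofReal_pow hD, mul_comm N 2, ← ENNReal.rpow_natCast]
        push_cast; rfl
    _ ≤ ENNReal.ofReal ((chainConst N * B) ^ 2) * ((T.card : ℝ≥0∞) ^ (2 * N : ℝ) *
          ∑ t ∈ T, (‖(fwdDiff h)^[t.1] w (x + t.2 • h)‖ₑ ^ (t.1 : ℝ)⁻¹) ^ (2 * N : ℝ)) := by
        rw [hDe]; gcongr; exact rpow_sum_le_card_rpow_mul _ _ hN0
    _ = _ := by
        rw [ENNReal.ofReal_mul (by positivity), mul_assoc]
        congr 2
        · rw [hcard, ENNReal.ofReal_pow (Nat.cast_nonneg _), ENNReal.ofReal_natCast,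
            ← ENNReal.rpow_natCast _ (2 * N)]
          congr 1
          push_cast
          ring
        · refine Finset.sum_congr rfl fun t _ => ?_
          rw [← ENNReal.rpow_mul, div_eq_inv_mul]

theorem exists_diffNormSq_comp_le (E V : Type) [NormedAddCommGroup E] [NormedSpace ℝ E]
    [NormedAddCommGroup V] [NormedSpace ℝ V] {s : ℝ} (hs : 0 < s) {N : ℕ} (hN : s < N) :
    ∃ C : ℝ, 0 ≤ C ∧ ∀ G : E → V, ContDiff ℝ N G → G 0 = 0 → ∀ B : ℝ, 0 ≤ B →
      (∀ k, 1 ≤ k → k ≤ N → ∀ y, ‖y‖ ≤ 1 → ‖iteratedFDeriv ℝ k G y‖ ≤ B) →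
      ∀ w : E3 → E, StronglyMeasurable w → (∀ x, ‖w x‖ ≤ 1) → ∫⁻ x, ‖w x‖ₑ ^ 2 < ⊤ →
        diffNormSq s N (fun x => G (w x)) ≤ ENNReal.ofReal (C * B ^ 2) * diffNormSq s N w := by
  have hN1 : 1 ≤ N := by
    rcases Nat.eq_zero_or_pos N with rfl | h
    · exact absurd (hs.trans hN) (by simp)
    · exact h
  obtain ⟨C, hC, hGN⟩ := exists_gagliardo_nirenberg E hs hN
  set T := Finset.Icc 1 N ×ˢ Finset.range (N + 1) with hT
  set c : ℝ := chainConst N ^ 2 * (N * (N + 1) : ℕ) ^ (2 * N) with hc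
  refine ⟨1 + c * (T.card * C), by positivity, fun G hG hG0 B hB hGB w hw hw1 hw2 => ?_⟩
  have hm : ∀ (h : E3) (n : ℕ) (r : ℝ), Measurable fun x => ‖(fwdDiff h)^[n] w x‖ₑ ^ r :=
    fun h n r => ((stronglyMeasurable_fwdDiff_iter hw n).comp_measurable
      measurable_prodMk_left).enorm.pow_const r
  have hL2 : ∫⁻ x, ‖G (w x)‖ₑ ^ 2 ≤ ENNReal.ofReal (B ^ 2) * ∫⁻ x, ‖w x‖ₑ ^ 2 := by
    rw [← lintegral_const_mul' _ _ ENNReal.ofReal_ne_top]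
    refine lintegral_mono fun x => ?_
    rw [← ofReal_norm, ← ofReal_norm, ← ENNReal.ofReal_pow (norm_nonneg _),
      ← ENNReal.ofReal_pow (norm_nonneg _), ← ENNReal.ofReal_mul (by positivity), ← mul_pow]
    refine ENNReal.ofReal_le_ofReal ?_
    gcongr
    exact norm_comp_le_of_norm_iteratedFDeriv_le hN1 hG hG0 (hGB 1 le_rfl hN1) (hw1 x)
  have hx : ∀ h : E3, ∫⁻ x, ‖(fwdDiff h)^[N] (fun z => G (w z)) x‖ₑ ^ 2 ≤
      ENNReal.ofReal (c * B ^ 2) * ∑ t ∈ T,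
        ∫⁻ x, ‖(fwdDiff h)^[t.1] w x‖ₑ ^ (2 * N / t.1 : ℝ) := by
    intro h
    refine (lintegral_mono fun x => enorm_fwdDiff_iter_comp_sq_le hN1 hG hB hGB hw1 h x).trans ?_
    rw [lintegral_const_mul' _ _ ENNReal.ofReal_ne_top,
      lintegral_finsetSum _ (f := fun (t : ℕ × ℕ) x =>
        ‖(fwdDiff h)^[t.1] w (x + t.2 • h)‖ₑ ^ (2 * N / t.1 : ℝ))
        (fun t _ => (hm h t.1 _).comp (measurable_add_const _))]
    refine le_of_eq ?_
    congr 1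
    · rw [hc]; ring_nf
    · exact Finset.sum_congr rfl fun t _ => lintegral_add_right_eq_self
        (fun x => ‖(fwdDiff h)^[t.1] w x‖ₑ ^ (2 * N / t.1 : ℝ)) (t.2 • h)
  set X := ∫⁻ h, diffWeight s h * ∫⁻ x, ‖(fwdDiff h)^[N] w x‖ₑ ^ 2 with hX
  have hh : ∫⁻ h, diffWeight s h * ∫⁻ x, ‖(fwdDiff h)^[N] (fun z => G (w z)) x‖ₑ ^ 2 ≤
      ENNReal.ofReal (c * (T.card * C) * B ^ 2) * X := by
    calc _ ≤ ∫⁻ h, ENNReal.ofReal (c * B ^ 2) * ∑ t ∈ T, diffWeight s h *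
          ∫⁻ x, ‖(fwdDiff h)^[t.1] w x‖ₑ ^ (2 * N / t.1 : ℝ) := by
          refine lintegral_mono fun h => ?_
          rw [← Finset.mul_sum, mul_left_comm]
          exact mul_le_mul' le_rfl (hx h)
      _ = ENNReal.ofReal (c * B ^ 2) * ∑ t ∈ T, ∫⁻ h, diffWeight s h *
          ∫⁻ x, ‖(fwdDiff h)^[t.1] w x‖ₑ ^ (2 * N / t.1 : ℝ) := by
          rw [lintegral_const_mul' _ _ ENNReal.ofReal_ne_top,
            lintegral_finsetSum _ (f := fun (t : ℕ × ℕ) h => diffWeight s h *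
              ∫⁻ x, ‖(fwdDiff h)^[t.1] w x‖ₑ ^ (2 * N / t.1 : ℝ)) (fun t _ =>
              (measurable_diffWeight s).mul (measurable_lintegral_fwdDiff_iter_rpow hw t.1 _))]
      _ ≤ ENNReal.ofReal (c * B ^ 2) * ∑ t ∈ T, ENNReal.ofReal C * X := by
          gcongr with t ht
          simp only [hT, Finset.mem_product, Finset.mem_Icc] at ht
          exact hGN w hw hw1 hw2 t.1 ht.1.1 ht.1.2
      _ = _ := by
          rw [Finset.sum_const, nsmul_eq_mul, ← ENNReal.ofReal_natCast, ← mul_assoc, ← mul_assoc,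
            ← ENNReal.ofReal_mul (by positivity), ← ENNReal.ofReal_mul (by positivity)]
          ring_nf
  rw [diffNormSq, diffNormSq, ← hX]
  have e : ENNReal.ofReal ((1 + c * (T.card * C)) * B ^ 2) =
      ENNReal.ofReal (B ^ 2) + ENNReal.ofReal (c * (T.card * C) * B ^ 2) := by
    rw [← ENNReal.ofReal_add (by positivity) (by positivity)]
    ring_nf
  rw [mul_add]
  refine add_le_add (hL2.trans ?_) (hh.trans ?_)
  · rw [e]; gcongr; exact le_self_add
  · rw [e]; gcongr; exact le_add_self

end MoserUnweighted

section Multiplication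

variable {V : Type*} [NormedAddCommGroup V] [NormedSpace ℝ V]

theorem norm_fwdDiff_iter_smul_le {M : Type*} [AddCommMonoid M] {n : ℕ} {χ : M → ℝ} {f : M → V}
    {h x : M} {A : ℝ}
    (hA : ∀ k j, k ≤ n → j ≤ n → ∀ y,
      ‖(fwdDiff h)^[k] χ y‖ * ‖(fwdDiff h)^[n - k] f (x + j • h)‖ ≤ A) :
    ‖(fwdDiff h)^[n] (fun z => χ z • f z) x‖ ≤ 2 ^ n * A := by
  induction n generalizing χ f with
  | zero => simpa [norm_smul] using hA 0 0 le_rfl le_rfl x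
  | succ n ih =>
    have hsplit : fwdDiff h (fun z => χ z • f z) =
        (fun z => (fwdDiff h χ z) • f (z + h)) + fun z => χ z • fwdDiff h f z := by
      ext z
      simp only [fwdDiff, Pi.add_apply]
      module
    rw [Function.iterate_succ_apply, hsplit, fwdDiff_iter_add, Pi.add_apply]
    have h1 := ih (χ := fwdDiff h χ) (f := fun z => f (z + h)) (fun k j hk hj y => by
      have := hA (k + 1) (j + 1) (by omega) (by omega) y
      rw [fwdDiff_iter_comp_add, ← Function.iterate_succ_apply]
      rwa [Nat.add_sub_add_right, add_smul, one_smul, ← add_assoc] at this)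
    have h2 := ih (χ := χ) (f := fwdDiff h f) (fun k j hk hj y => by
      have := hA k j (by omega) (by omega) y
      rw [← Function.iterate_succ_apply]
      rwa [show n + 1 - k = (n - k).succ by omega] at this)
    calc _ ≤ _ := norm_add_le _ _
      _ ≤ _ := add_le_add h1 h2
      _ = _ := by ring

theorem norm_fwdDiff_iter_le_min_pow {N : ℕ} {χ : E3 → ℝ} (hχ : ContDiff ℝ N χ) {B : ℝ}
    (hB : 0 ≤ B) (hχB : ∀ k ≤ N, ∀ x, ‖iteratedFDeriv ℝ k χ x‖ ≤ B) (h : E3) {k : ℕ}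
    (hk : k ≤ N) (x : E3) :
    ‖(fwdDiff h)^[k] χ x‖ ≤ (2 ^ N + chainConst N) * B * (min 1 ‖h‖) ^ k := by
  have hc : 0 ≤ chainConst N := zero_le_one.trans (one_le_chainConst N)
  have h0 : ∀ x, ‖χ x‖ ≤ B := fun x => by simpa using hχB 0 (Nat.zero_le _) x
  have h1 : ‖(fwdDiff h)^[k] χ x‖ ≤ 2 ^ N * B :=
    (norm_fwdDiff_iter_le h0 h k x).trans (by gcongr; exact one_le_two)
  have h3 : ‖(fwdDiff h)^[k] χ x‖ ≤ (2 ^ N + chainConst N) * B * ‖h‖ ^ k := by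
    rcases Nat.eq_zero_or_pos k with rfl | hk0
    · rw [pow_zero, mul_one]
      nlinarith
    · have hu1 : fwdDiff 1 (fun i : ℕ => x + i • h) = fun _ => h := by
        ext1 i
        simp [fwdDiff, add_smul]
      have hu2 : ∀ k j, 1 ≤ k → j + k ≤ N →
          ‖(fwdDiff 1)^[k] (fun i : ℕ => x + i • h) j‖ ≤ ‖h‖ ^ k := by
        intro k j hk _
        obtain ⟨k, rfl⟩ : ∃ k', k = k' + 1 := ⟨k - 1, by omega⟩
        rw [Function.iterate_succ_apply, hu1]
        rcases Nat.eq_zero_or_pos k with rfl | hk0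
        · simp
        · obtain ⟨k, rfl⟩ : ∃ k', k = k' + 1 := ⟨k - 1, by omega⟩
          rw [Function.iterate_succ_apply, fwdDiff_const]
          have : (fwdDiff 1)^[k] (fun _ : ℕ => (0:E3)) = fun _ => 0 :=
            Function.iterate_fixed (fwdDiff_const 1 (0:E3)) k
          rw [this, norm_zero]
          positivity
      have := norm_fwdDiff_iter_comp_le N hχ convex_univ hB (norm_nonneg h)
        (fun k _ hk y _ => hχB k hk y) (u := fun i => x + i • h) (fun _ => mem_univ _) hu2 k 0 hk0
        (by omega)
      rw [fwdDiff_iter_comp_nsmul, zero_smul, add_zero] at this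
      refine this.trans ?_
      gcongr
      exact le_add_of_nonneg_left (by positivity)
  rcases le_total 1 ‖h‖ with hh | hh
  · rw [min_eq_left hh, one_pow, mul_one]
    nlinarith
  · rw [min_eq_right hh]
    exact h3

theorem enorm_fwdDiff_iter_smul_sq_le {N : ℕ} {χ : E3 → ℝ} (hχ : ContDiff ℝ N χ) {B : ℝ}
    (hB : 0 ≤ B) (hχB : ∀ k ≤ N, ∀ x, ‖iteratedFDeriv ℝ k χ x‖ ≤ B) (f : E3 → V) (h x : E3) :
    ‖(fwdDiff h)^[N] (fun z => χ z • f z) x‖ₑ ^ 2 ≤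
      ENNReal.ofReal ((2 ^ N * ((2 ^ N + chainConst N) * B)) ^ 2) *
        ∑ t ∈ Finset.range (N + 1) ×ˢ Finset.range (N + 1),
          ENNReal.ofReal ((min 1 ‖h‖) ^ (2 * t.1)) *
            ‖(fwdDiff h)^[N - t.1] f (x + t.2 • h)‖ₑ ^ 2 := by
  have hc : 0 ≤ chainConst N := zero_le_one.trans (one_le_chainConst N)
  set T := Finset.range (N + 1) ×ˢ Finset.range (N + 1) with hT
  set g : ℕ × ℕ → ℝ := fun t => (min 1 ‖h‖) ^ t.1 * ‖(fwdDiff h)^[N - t.1] f (x + t.2 • h)‖ with hg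
  set S : ℝ := ∑ t ∈ T, g t ^ 2 with hS
  have hS0 : 0 ≤ S := Finset.sum_nonneg fun _ _ => sq_nonneg _
  have key := norm_fwdDiff_iter_smul_le (n := N) (χ := χ) (f := f) (h := h) (x := x)
    (A := (2 ^ N + chainConst N) * B * √S) (fun k j hk hj y => by
      have h1 := norm_fwdDiff_iter_le_min_pow hχ hB hχB h hk y
      have h2 : g (k, j) ≤ √S := by
        refine Real.le_sqrt_of_sq_le ?_
        exact Finset.single_le_sum (f := fun t => g t ^ 2) (fun _ _ => sq_nonneg _)
          (show (k, j) ∈ T by simp only [hT, Finset.mem_product, Finset.mem_range]; omega)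
      calc _ ≤ (2 ^ N + chainConst N) * B * (min 1 ‖h‖) ^ k *
            ‖(fwdDiff h)^[N - k] f (x + j • h)‖ := by gcongr
        _ = (2 ^ N + chainConst N) * B * g (k, j) := by simp only [hg]; ring
        _ ≤ _ := by gcongr)
  calc _ ≤ ENNReal.ofReal (2 ^ N * ((2 ^ N + chainConst N) * B * √S)) ^ 2 := by
        rw [← ofReal_norm]; gcongr
    _ = ENNReal.ofReal ((2 ^ N * ((2 ^ N + chainConst N) * B)) ^ 2) * ENNReal.ofReal S := by
        rw [← ENNReal.ofReal_pow (by positivity), ← ENNReal.ofReal_mul (by positivity), ← mul_assoc,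
          mul_pow, Real.sq_sqrt hS0]
    _ = _ := by
        rw [hS, ENNReal.ofReal_sum_of_nonneg (fun _ _ => sq_nonneg _)]
        congr 1
        refine Finset.sum_congr rfl fun t _ => ?_
        rw [← ofReal_norm, ← ENNReal.ofReal_pow (norm_nonneg _), ← ENNReal.ofReal_mul (by positivity)]
        simp only [hg]
        ring_nf

theorem exists_diffNormSq_mul_le {s : ℝ} (hs : 0 < s) {N : ℕ} (hN : s < N) :
    ∃ C : ℝ, 0 ≤ C ∧ ∀ χ : E3 → ℝ, ContDiff ℝ N χ → ∀ B : ℝ, 0 ≤ B →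
      (∀ k ≤ N, ∀ x, ‖iteratedFDeriv ℝ k χ x‖ ≤ B) → ∀ f : E3 → ℂ, StronglyMeasurable f →
      Integrable f → MemLp f 2 →
        diffNormSq s N (fun x => χ x • f x) ≤ ENNReal.ofReal (C * B ^ 2) * HsNormSq s f := by
  obtain ⟨C, hC, hD⟩ := exists_lintegral_fwdDiff_le_HsNormSq hs hN
  have hc : 0 ≤ chainConst N := zero_le_one.trans (one_le_chainConst N)
  set T := Finset.range (N + 1) ×ˢ Finset.range (N + 1) with hT
  set c : ℝ := (2 ^ N * (2 ^ N + chainConst N)) ^ 2 with hcdef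
  refine ⟨1 + c * (T.card * C), by positivity, fun χ hχ B hB hχB f hf hfi hf2 => ?_⟩
  have hm : ∀ (h : E3) (n : ℕ), Measurable fun x => ‖(fwdDiff h)^[n] f x‖ₑ ^ 2 :=
    fun h n => ((stronglyMeasurable_fwdDiff_iter hf n).comp_measurable
      measurable_prodMk_left).enorm.pow_const 2
  have hmh : ∀ n : ℕ, Measurable fun h => ∫⁻ x, ‖(fwdDiff h)^[n] f x‖ₑ ^ 2 :=
    fun n => ((stronglyMeasurable_fwdDiff_iter hf n).enorm.pow_const 2).lintegral_prod_right'
  have hL2 : ∫⁻ x, ‖χ x • f x‖ₑ ^ 2 ≤ ENNReal.ofReal (B ^ 2) * HsNormSq s f := by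
    refine le_trans ?_ (mul_le_mul' le_rfl (lintegral_sq_le_HsNormSq hs hfi hf2))
    rw [← lintegral_const_mul' _ _ ENNReal.ofReal_ne_top]
    refine lintegral_mono fun x => ?_
    rw [enorm_smul, mul_pow, ← ofReal_norm (χ x), ← ENNReal.ofReal_pow (norm_nonneg _)]
    gcongr
    simpa using hχB 0 (Nat.zero_le _) x
  have hx : ∀ h : E3, ∫⁻ x, ‖(fwdDiff h)^[N] (fun z => χ z • f z) x‖ₑ ^ 2 ≤
      ENNReal.ofReal (c * B ^ 2) * ∑ t ∈ T, ENNReal.ofReal ((min 1 ‖h‖) ^ (2 * t.1)) *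
        ∫⁻ x, ‖(fwdDiff h)^[N - t.1] f x‖ₑ ^ 2 := by
    intro h
    refine (lintegral_mono fun x => enorm_fwdDiff_iter_smul_sq_le hχ hB hχB f h x).trans ?_
    rw [lintegral_const_mul' _ _ ENNReal.ofReal_ne_top,
      lintegral_finsetSum _ (f := fun (t : ℕ × ℕ) x => ENNReal.ofReal ((min 1 ‖h‖) ^ (2 * t.1)) *
        ‖(fwdDiff h)^[N - t.1] f (x + t.2 • h)‖ₑ ^ 2)
        (fun t _ => ((hm h (N - t.1)).comp (measurable_add_const _)).const_mul _)]
    refine le_of_eq ?_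
    congr 1
    · rw [hcdef]; ring_nf
    · refine Finset.sum_congr rfl fun t _ => ?_
      rw [lintegral_const_mul' _ _ ENNReal.ofReal_ne_top]
      congr 1
      exact lintegral_add_right_eq_self (fun x => ‖(fwdDiff h)^[N - t.1] f x‖ₑ ^ 2) (t.2 • h)
  have hh : ∫⁻ h, diffWeight s h * ∫⁻ x, ‖(fwdDiff h)^[N] (fun z => χ z • f z) x‖ₑ ^ 2 ≤
      ENNReal.ofReal (c * (T.card * C) * B ^ 2) * HsNormSq s f := by
    calc _ ≤ ∫⁻ h, ENNReal.ofReal (c * B ^ 2) * ∑ t ∈ T, diffWeight s h *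
          (ENNReal.ofReal ((min 1 ‖h‖) ^ (2 * t.1)) *
            ∫⁻ x, ‖(fwdDiff h)^[N - t.1] f x‖ₑ ^ 2) := by
          refine lintegral_mono fun h => ?_
          rw [← Finset.mul_sum, mul_left_comm]
          exact mul_le_mul' le_rfl (hx h)
      _ = ENNReal.ofReal (c * B ^ 2) * ∑ t ∈ T, ∫⁻ h, diffWeight s h *
          (ENNReal.ofReal ((min 1 ‖h‖) ^ (2 * t.1)) *
            ∫⁻ x, ‖(fwdDiff h)^[N - t.1] f x‖ₑ ^ 2) := by
          rw [lintegral_const_mul' _ _ ENNReal.ofReal_ne_top,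
            lintegral_finsetSum _ (f := fun (t : ℕ × ℕ) h => diffWeight s h *
              (ENNReal.ofReal ((min 1 ‖h‖) ^ (2 * t.1)) *
                ∫⁻ x, ‖(fwdDiff h)^[N - t.1] f x‖ₑ ^ 2)) (fun t _ =>
              (measurable_diffWeight s).mul
                ((by fun_prop : Measurable fun h : E3 =>
                  ENNReal.ofReal ((min 1 ‖h‖) ^ (2 * t.1))).mul (hmh _)))]
      _ ≤ ENNReal.ofReal (c * B ^ 2) * ∑ t ∈ T, ENNReal.ofReal C * HsNormSq s f := by
          gcongr with t ht
          simp only [hT, Finset.mem_product, Finset.mem_range] at ht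
          exact hD f hfi hf2 t.1 (by omega)
      _ = _ := by
          rw [Finset.sum_const, nsmul_eq_mul, ← ENNReal.ofReal_natCast, ← mul_assoc, ← mul_assoc,
            ← ENNReal.ofReal_mul (by positivity), ← ENNReal.ofReal_mul (by positivity)]
          ring_nf
  rw [diffNormSq]
  refine (add_le_add hL2 hh).trans_eq ?_
  rw [← add_mul, ← ENNReal.ofReal_add (by positivity) (by positivity)]
  ring_nf

end Multiplication

theorem fwdDiff_iter_comp_smul {V : Type*} [AddCommGroup V] (f : E3 → V) (c : ℝ) (h : E3) (k : ℕ)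
    (x : E3) : (fwdDiff h)^[k] (fun z => f (c • z)) x = (fwdDiff (c • h))^[k] f (c • x) := by
  induction k generalizing x with
  | zero => rfl
  | succ k ih => simp only [Function.iterate_succ_apply', fwdDiff, ih, smul_add]

theorem diffNormSq_comp_smul_le {V : Type*} [NormedAddCommGroup V] (s : ℝ) (N : ℕ) (f : E3 → V)
    {c : ℝ} (hc : 0 < c) : diffNormSq s N (fun x => f (c • x)) ≤
      ENNReal.ofReal ((c ^ 3)⁻¹ * (1 + c ^ (2 * s))) * diffNormSq s N f := by
  have h1 := lintegral_comp_smul_E3 hc (fun x => ‖f x‖ₑ ^ 2)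
  have h2 : ∀ h : E3, ∫⁻ x, ‖(fwdDiff h)^[N] (fun z => f (c • z)) x‖ₑ ^ 2 =
      ENNReal.ofReal ((c ^ 3)⁻¹) * ∫⁻ x, ‖(fwdDiff (c • h))^[N] f x‖ₑ ^ 2 := fun h => by
    simp only [fwdDiff_iter_comp_smul]
    exact lintegral_comp_smul_E3 hc (fun x => ‖(fwdDiff (c • h))^[N] f x‖ₑ ^ 2)
  have h3 := lintegral_diffWeight_comp_smul s hc (fun h => ∫⁻ x, ‖(fwdDiff h)^[N] f x‖ₑ ^ 2)
  rw [diffNormSq, h1]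
  simp only [h2, mul_left_comm (diffWeight s _)]
  rw [lintegral_const_mul' _ _ ENNReal.ofReal_ne_top, h3, ENNReal.ofReal_mul (by positivity),
    ENNReal.ofReal_add zero_le_one (by positivity), ENNReal.ofReal_one, ← mul_add, mul_assoc]
  gcongr
  rw [diffNormSq, mul_add]
  refine add_le_add (le_mul_of_one_le_left' le_self_add) ?_
  gcongr
  exact le_add_self

theorem diffNormSq_sum_le {V ι : Type*} [NormedAddCommGroup V] (s : ℝ) (N : ℕ) (t : Finset ι)
    {f : ι → E3 → V} (hf : ∀ i ∈ t, StronglyMeasurable (f i)) :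
    diffNormSq s N (fun x => ∑ i ∈ t, f i x) ≤
      (t.card : ℝ≥0∞) ^ 2 * ∑ i ∈ t, diffNormSq s N (f i) := by
  have hsq : ∀ a : ι → V, ‖∑ i ∈ t, a i‖ₑ ^ 2 ≤ (t.card : ℝ≥0∞) ^ 2 * ∑ i ∈ t, ‖a i‖ₑ ^ 2 := by
    intro a
    have := rpow_sum_le_card_rpow_mul t (fun i => ‖a i‖ₑ) two_pos
    simp only [ENNReal.rpow_two] at this
    refine le_trans ?_ this
    gcongr
    exact enorm_sum_le _ _
  have hfun : (fun x => ∑ i ∈ t, f i x) = ∑ i ∈ t, f i := by ext x; simp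
  have hct : ((t.card : ℝ≥0∞) ^ 2) ≠ ⊤ := by simp
  have hx : ∀ h : E3, ∫⁻ x, ‖(fwdDiff h)^[N] (fun x => ∑ i ∈ t, f i x) x‖ₑ ^ 2 ≤
      (t.card : ℝ≥0∞) ^ 2 * ∑ i ∈ t, ∫⁻ x, ‖(fwdDiff h)^[N] (f i) x‖ₑ ^ 2 := by
    intro h
    rw [hfun, fwdDiff_iter_finsetSum, ← lintegral_finsetSum _
      (f := fun i x => ‖(fwdDiff h)^[N] (f i) x‖ₑ ^ 2) (fun i hi =>
      ((stronglyMeasurable_fwdDiff_iter (hf i hi) N).comp_measurable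
      measurable_prodMk_left).enorm.pow_const 2), ← lintegral_const_mul' _ _ hct]
    refine lintegral_mono fun x => ?_
    rw [Finset.sum_apply]
    exact hsq _
  simp only [diffNormSq]
  rw [Finset.sum_add_distrib, mul_add]
  refine add_le_add ?_ ?_
  · rw [← lintegral_finsetSum _ (fun i hi => (hf i hi).enorm.pow_const 2),
      ← lintegral_const_mul' _ _ hct]
    exact lintegral_mono fun x => hsq _
  · rw [← lintegral_finsetSum _ (f := fun i h => diffWeight s h *
      ∫⁻ x, ‖(fwdDiff h)^[N] (f i) x‖ₑ ^ 2) (fun i hi => (measurable_diffWeight s).mul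
      ((stronglyMeasurable_fwdDiff_iter (hf i hi) N).enorm.pow_const 2).lintegral_prod_right'),
      ← lintegral_const_mul' _ _ hct]
    refine lintegral_mono fun h => ?_
    rw [← Finset.mul_sum, mul_left_comm]
    exact mul_le_mul' le_rfl (hx h)

theorem fwdDiff_iter_map {M V W : Type*} [AddCommMonoid M] [AddCommGroup V] [AddCommGroup W]
    (φ : V →+ W) (f : M → V) (h : M) (n : ℕ) (x : M) :
    (fwdDiff h)^[n] (fun y => φ (f y)) x = φ ((fwdDiff h)^[n] f x) := by
  induction n generalizing x with
  | zero => rfl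
  | succ n ih => simp only [Function.iterate_succ_apply', fwdDiff, ih, map_sub]

theorem diffNormSq_map_le {V W : Type*} [NormedAddCommGroup V] [NormedAddCommGroup W] (s : ℝ)
    (N : ℕ) (φ : V →+ W) {K : ℝ≥0∞} (hK : K ≠ ⊤) (hφ : ∀ v, ‖φ v‖ₑ ≤ K * ‖v‖ₑ) (f : E3 → V) :
    diffNormSq s N (fun x => φ (f x)) ≤ K ^ 2 * diffNormSq s N f := by
  have hsq : ∀ v, ‖φ v‖ₑ ^ 2 ≤ K ^ 2 * ‖v‖ₑ ^ 2 := fun v => by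
    rw [← mul_pow]; exact pow_le_pow_left' (hφ v) 2
  have hK2 : K ^ 2 ≠ ⊤ := ENNReal.pow_ne_top hK
  unfold diffNormSq
  rw [mul_add]
  refine add_le_add ?_ ?_
  · rw [← lintegral_const_mul' _ _ hK2]
    exact lintegral_mono fun x => hsq _
  · rw [← lintegral_const_mul' _ _ hK2]
    refine lintegral_mono fun h => ?_
    rw [mul_left_comm]
    gcongr
    rw [← lintegral_const_mul' _ _ hK2]
    refine lintegral_mono fun x => ?_
    rw [fwdDiff_iter_map]
    exact hsq _

theorem diffNormSq_const_smul_le {V : Type*} [NormedAddCommGroup V] [NormedSpace ℝ V] (s : ℝ)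
    (N : ℕ) {c : ℝ} (hc : 0 ≤ c) (f : E3 → V) :
    diffNormSq s N (fun x => c • f x) ≤ ENNReal.ofReal (c ^ 2) * diffNormSq s N f := by
  rw [ENNReal.ofReal_pow hc]
  refine diffNormSq_map_le s N (DistribSMul.toAddMonoidHom V c) ENNReal.ofReal_ne_top (fun v => ?_) f
  change ‖c • v‖ₑ ≤ _
  rw [enorm_smul, Real.enorm_of_nonneg hc]

theorem diffNormSq_apply_le {l : ℕ} (s : ℝ) (N : ℕ) (f : E3 → EuclideanSpace ℝ (Fin l))
    (i : Fin l) : diffNormSq s N (fun x => f x i) ≤ diffNormSq s N f := by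
  have h := diffNormSq_map_le s N
    ((EuclideanSpace.proj i : EuclideanSpace ℝ (Fin l) →L[ℝ] ℝ) : _ →+ ℝ) (K := 1)
    ENNReal.one_ne_top (fun v => ?_) f
  · simpa using h
  · rw [one_mul, enorm_le_iff_norm_le]
    exact PiLp.norm_apply_le v i

theorem diffNormSq_le_sum_apply {m : ℕ} (s : ℝ) (N : ℕ) {f : E3 → EuclideanSpace ℝ (Fin m)}
    (hf : StronglyMeasurable f) :
    diffNormSq s N f ≤ (m : ℝ≥0∞) ^ 2 * ∑ i, diffNormSq s N (fun x => f x i) := by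
  have hfi : ∀ i, StronglyMeasurable fun x => f x i := fun i =>
    (EuclideanSpace.proj (𝕜 := ℝ) i).continuous.comp_stronglyMeasurable hf
  have hsum : f = fun x => ∑ i, f x i • EuclideanSpace.single i (1 : ℝ) := by
    funext x
    ext j
    simp [Pi.single_apply]
  have h := diffNormSq_sum_le s N Finset.univ
    (f := fun i x => f x i • EuclideanSpace.single i (1 : ℝ))
    fun i _ => (hfi i).smul_const _
  rw [← hsum, Finset.card_univ, Fintype.card_fin] at h
  refine h.trans ?_
  gcongr with i
  have hi := diffNormSq_map_le s N
    ((LinearMap.toSpanSingleton ℝ (EuclideanSpace ℝ (Fin m))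
      (EuclideanSpace.single i (1 : ℝ))).toAddMonoidHom) (K := 1) ENNReal.one_ne_top
    (fun v => ?_) (fun x => f x i)
  · simpa using hi
  · have : ‖(EuclideanSpace.single i 1 : EuclideanSpace ℝ (Fin m))‖ₑ = 1 := by
      rw [← ofReal_norm, PiLp.norm_single, norm_one, ENNReal.ofReal_one]
    simp [enorm_smul, this]

/-- The Moser estimate without weights, for functions bounded by `r`. -/
theorem exists_diffNormSq_comp_le_of_bound (E V : Type) [NormedAddCommGroup E] [NormedSpace ℝ E]
    [NormedAddCommGroup V] [NormedSpace ℝ V] [CompleteSpace V] {s : ℝ} (hs : 0 < s) {N : ℕ}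
    (hN : s < N) :
    ∃ C : ℝ, 0 ≤ C ∧ ∀ F : E → V, ContDiff ℝ N F → F 0 = 0 → ∀ r M : ℝ, 0 < r →
      (∀ k ≤ N, ∀ y, ‖y‖ ≤ r → ‖iteratedFDeriv ℝ k F y‖ ≤ M) →
      ∀ v : E3 → E, StronglyMeasurable v → (∀ x, ‖v x‖ ≤ r) → ∫⁻ x, ‖v x‖ₑ ^ 2 < ⊤ →
        diffNormSq s N (fun x => F (v x)) ≤
          ENNReal.ofReal (C * (M * (1 + r ^ N)) ^ 2) * diffNormSq s N v := by
  obtain ⟨C, hC, H⟩ := exists_diffNormSq_comp_le E V hs hN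
  refine ⟨C, hC, fun F hF hF0 r M hr hM v hv hvr hv2 => ?_⟩
  have hM0 : 0 ≤ M := (norm_nonneg _).trans (hM 0 (Nat.zero_le _) 0 (by simpa using hr.le))
  have hw : ∀ x, ‖r⁻¹ • v x‖ ≤ 1 := fun x => by
    rw [norm_smul, norm_inv, Real.norm_of_nonneg hr.le, inv_mul_le_iff₀ hr, mul_one]
    exact hvr x
  have hB : ∀ k, 1 ≤ k → k ≤ N → ∀ y : E, ‖y‖ ≤ 1 →
      ‖iteratedFDeriv ℝ k (fun y => F (r • y)) y‖ ≤ M * (r * (1 + r ^ N)) := by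
    intro k hk1 hkN y hy
    rw [iteratedFDeriv_comp_const_smul (i := k) r (hF.of_le (by exact_mod_cast hkN)),
      norm_smul, norm_pow,
      Real.norm_of_nonneg hr.le, mul_comm]
    refine mul_le_mul (hM k hkN _ ?_) ?_ (by positivity) hM0
    · rw [norm_smul, Real.norm_of_nonneg hr.le]
      exact mul_le_of_le_one_right hr.le hy
    · obtain ⟨k, rfl⟩ := Nat.exists_eq_add_of_le hk1
      rw [pow_add, pow_one]
      refine mul_le_mul_of_nonneg_left ?_ hr.le
      rcases le_total r 1 with h1 | h1
      · exact (pow_le_one₀ hr.le h1).trans (by linarith [pow_nonneg hr.le N])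
      · exact (pow_le_pow_right₀ h1 (show k ≤ N by omega)).trans (by linarith)
  have hw2 : ∫⁻ x, ‖r⁻¹ • v x‖ₑ ^ 2 < ⊤ := by
    simp only [enorm_smul, mul_pow]
    rw [lintegral_const_mul' _ _ (by simp)]
    exact ENNReal.mul_lt_top (by simp) hv2
  have h1 := H (fun y => F (r • y)) (hF.comp (contDiff_id.const_smul r)) (by simpa using hF0)
    (M * (r * (1 + r ^ N))) (by positivity) hB (fun x => r⁻¹ • v x) (hv.const_smul _) hw hw2
  simp only [smul_inv_smul₀ hr.ne'] at h1
  refine h1.trans ((mul_le_mul_right (diffNormSq_const_smul_le s N (inv_nonneg.2 hr.le) v) _).trans_eq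
    ?_)
  rw [← mul_assoc, ← ENNReal.ofReal_mul (by positivity)]
  congr 2
  field_simp

/-- A smooth function equal to `t⁻¹` for `1 ≤ t`, with `0 ≤ t * cutInv t ≤ 1` everywhere. -/
def cutInv (t : ℝ) : ℝ := Real.smoothTransition (2 * t - 1) / t

theorem contDiff_cutInv {n : ℕ} : ContDiff ℝ n cutInv := by
  rw [contDiff_iff_contDiffAt]
  intro t
  by_cases ht : t = 0
  · have : cutInv =ᶠ[nhds t] fun _ => 0 := by
      filter_upwards [Iio_mem_nhds (show t < 1 / 2 by rw [ht]; norm_num)] with y hy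
      have hy' : 2 * y - 1 ≤ 0 := by linarith [Set.mem_Iio.1 hy]
      rw [cutInv, Real.smoothTransition.zero_of_nonpos hy', zero_div]
    exact contDiffAt_const.congr_of_eventuallyEq this
  · exact ContDiffAt.div (Real.smoothTransition.contDiff.comp (by fun_prop)).contDiffAt
      contDiffAt_id ht

theorem cutInv_mul_self_nonneg (t : ℝ) : 0 ≤ cutInv t * t := by
  by_cases ht : t = 0
  · simp [ht]
  · rw [cutInv, div_mul_cancel₀ _ ht]; exact Real.smoothTransition.nonneg _

theorem cutInv_mul_self_le_one (t : ℝ) : cutInv t * t ≤ 1 := by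
  by_cases ht : t = 0
  · simp [ht]
  · rw [cutInv, div_mul_cancel₀ _ ht]; exact Real.smoothTransition.le_one _

theorem cutInv_mul_self_eq_one {t : ℝ} (ht : 1 ≤ t) : cutInv t * t = 1 := by
  rw [cutInv, div_mul_cancel₀ _ (by positivity),
    Real.smoothTransition.one_of_one_le (by linarith)]

namespace DyadicPartition

variable (P : DyadicPartition)

/-- The indices of the dyadic pieces adjacent to the `j`-th one. -/
def nbr (j : ℕ) : Finset ℕ := Finset.Icc (j - 1) (j + 1)

theorem mem_nbr {j k : ℕ} : k ∈ nbr j ↔ j ≤ k + 1 ∧ k ≤ j + 1 := by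
  rw [nbr, Finset.mem_Icc]; omega

theorem card_nbr_le (j : ℕ) : (nbr j).card ≤ 3 := by
  rw [nbr, Nat.card_Icc]; omega

theorem norm_le_of_ne_zero {k : ℕ} {x : E3} (h : P.ψ k x ≠ 0) : ‖x‖ ≤ (2 : ℝ) ^ (k + 1) := by
  rcases Nat.eq_zero_or_pos k with rfl | hk
  · simpa using P.supp_zero x h
  · exact_mod_cast (P.supp_succ k hk x h).2

theorem apply_smul_eq_zero {j k : ℕ} (hk : k ≤ j + 1) {x : E3} (hx : 4 < ‖x‖) :
    P.ψ k ((2 : ℝ) ^ j • x) = 0 := by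
  by_contra h
  have h1 := P.norm_le_of_ne_zero h
  rw [norm_smul, norm_pow, Real.norm_ofNat] at h1
  have h2 : (2 : ℝ) ^ (k + 1) ≤ 2 ^ j * 4 := by
    calc (2 : ℝ) ^ (k + 1) ≤ 2 ^ (j + 2) := pow_le_pow_right₀ (by norm_num) (by omega)
      _ = 2 ^ j * 4 := by rw [pow_add]; norm_num
  have h3 : (2 : ℝ) ^ j * 4 < 2 ^ j * ‖x‖ := by gcongr
  linarith

theorem one_le_sum_nbr {j : ℕ} {x : E3} (h : P.ψ j x ≠ 0) : 1 ≤ ∑ k ∈ nbr j, P.ψ k x := by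
  suffices ∃ k ∈ nbr j, P.ψ k x = 1 by
    obtain ⟨k, hk, h1⟩ := this
    rw [← h1]
    exact Finset.single_le_sum (f := fun k => P.ψ k x) (fun i _ => P.nonneg i x) hk
  rcases Nat.eq_zero_or_pos j with rfl | hj
  · rcases le_total ‖x‖ 1 with h1 | h1
    · exact ⟨0, mem_nbr.2 (by omega), P.one_zero x h1⟩
    · exact ⟨1, mem_nbr.2 (by omega), P.one_succ 1 le_rfl x (by simpa using h1)
        (by simpa using P.supp_zero x h)⟩
  · obtain ⟨hlo, hhi⟩ := P.supp_succ j hj x h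
    rcases le_total ‖x‖ ((2 : ℝ) ^ (j : ℤ)) with h1 | h1
    · rcases le_total ‖x‖ ((2 : ℝ) ^ ((j : ℤ) - 1)) with h2 | h2
      · obtain ⟨i, rfl⟩ := Nat.exists_eq_add_of_le' hj
        refine ⟨i, mem_nbr.2 (by omega), ?_⟩
        rcases Nat.eq_zero_or_pos i with rfl | hi
        · exact P.one_zero x (by simpa using h2)
        · refine P.one_succ i hi x ?_ ?_
          · convert hlo using 2; push_cast; omega
          · simpa using h2
      · exact ⟨j, mem_nbr.2 (by omega), P.one_succ j hj x h2 h1⟩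
    · refine ⟨j + 1, mem_nbr.2 (by omega), P.one_succ (j + 1) (by omega) x ?_ ?_⟩
      · simpa using h1
      · convert hhi using 2; push_cast; omega

theorem exists_norm_iteratedFDeriv_comp_smul_le (N : ℕ) :
    ∃ B : ℝ, 0 ≤ B ∧ ∀ j k, k ∈ nbr j → ∀ n ≤ N, ∀ x,
      ‖iteratedFDeriv ℝ n (fun x => P.ψ k ((2 : ℝ) ^ j • x)) x‖ ≤ B := by
  choose C hC using P.deriv_bound
  refine ⟨∑ n ∈ Finset.range (N + 1), |C n| * 2 ^ n, by positivity, fun j k hk n hn x => ?_⟩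
  refine le_trans ?_ (Finset.single_le_sum (f := fun n => |C n| * 2 ^ n)
    (fun i _ => by positivity) (Finset.mem_range.2 (Nat.lt_succ_of_le hn)))
  rw [iteratedFDeriv_comp_const_smul (i := n) _
    ((P.smooth k).of_le (by exact_mod_cast le_top)), norm_smul, norm_pow, norm_pow,
    Real.norm_ofNat]
  calc ((2 : ℝ) ^ j) ^ n * ‖iteratedFDeriv ℝ n (P.ψ k) ((2 : ℝ) ^ j • x)‖
      ≤ ((2 : ℝ) ^ j) ^ n * (|C n| * 2 ^ (-(n : ℤ) * (k : ℤ))) := by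
        gcongr
        exact (hC n k _).trans (by gcongr; exact le_abs_self _)
    _ = |C n| * (2 : ℝ) ^ ((n : ℤ) * ((j : ℤ) - k)) := by
        rw [mul_left_comm, ← pow_mul, ← zpow_natCast, ← zpow_add₀ (by norm_num)]
        congr 2; push_cast; ring
    _ ≤ |C n| * 2 ^ n := by
        rw [← zpow_natCast]
        gcongr
        · norm_num
        · have := (mem_nbr.1 hk).1
          nlinarith

theorem exists_norm_iteratedFDeriv_cutInv_comp_smul_le (N : ℕ) :
    ∃ B : ℝ, 0 ≤ B ∧ ∀ j, ∀ n ≤ N, ∀ x,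
      ‖iteratedFDeriv ℝ n (fun x => cutInv (∑ k ∈ nbr j, P.ψ k ((2 : ℝ) ^ j • x))) x‖ ≤ B := by
  obtain ⟨B, hB0, hB⟩ := P.exists_norm_iteratedFDeriv_comp_smul_le N
  have hψ : ∀ j k, ContDiff ℝ N (fun x => P.ψ k ((2 : ℝ) ^ j • x)) := fun j k =>
    ((P.smooth k).of_le (by exact_mod_cast le_top)).comp (contDiff_id.const_smul _)
  have hsum : ∀ j, ∀ n ≤ N, ∀ x,
      ‖iteratedFDeriv ℝ n (fun x => ∑ k ∈ nbr j, P.ψ k ((2 : ℝ) ^ j • x)) x‖ ≤ 3 * B := by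
    intro j n hn x
    rw [iteratedFDeriv_fun_sum_apply fun k _ =>
      ((hψ j k).of_le (by exact_mod_cast hn)).contDiffAt]
    refine (norm_sum_le_of_le _ fun k hk => hB j k hk n hn x).trans ?_
    rw [Finset.sum_const, nsmul_eq_mul]
    gcongr
    exact_mod_cast card_nbr_le j
  have hσ : ∃ K : ℝ, 0 ≤ K ∧ ∀ n ≤ N, ∀ t ∈ Icc (-(3 * B)) (3 * B),
      ‖iteratedFDeriv ℝ n cutInv t‖ ≤ K := by
    have : ∀ n : ℕ, ∃ K : ℝ, ∀ t ∈ Icc (-(3 * B)) (3 * B), ‖iteratedFDeriv ℝ n cutInv t‖ ≤ K :=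
      fun n => isCompact_Icc.exists_bound_of_continuousOn
        ((contDiff_cutInv (n := n)).continuous_iteratedFDeriv le_rfl).continuousOn
    choose K hK using this
    refine ⟨∑ n ∈ Finset.range (N + 1), |K n|, by positivity, fun n hn t ht => ?_⟩
    exact ((hK n t ht).trans (le_abs_self _)).trans
      (Finset.single_le_sum (f := fun n => |K n|) (fun i _ => abs_nonneg _)
        (Finset.mem_range.2 (Nat.lt_succ_of_le hn)))
  obtain ⟨K, hK0, hK⟩ := hσ
  refine ⟨(N.factorial : ℝ) * K * (1 + 3 * B) ^ N, by positivity, fun j n hn x => ?_⟩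
  have hx : ∑ k ∈ nbr j, P.ψ k ((2 : ℝ) ^ j • x) ∈ Icc (-(3 * B)) (3 * B) := by
    rw [Set.mem_Icc, ← abs_le, ← Real.norm_eq_abs, ← norm_iteratedFDeriv_zero (𝕜 := ℝ)
      (f := fun x => ∑ k ∈ nbr j, P.ψ k ((2 : ℝ) ^ j • x))]
    exact hsum j 0 (Nat.zero_le _) x
  refine (norm_iteratedFDeriv_comp_le (n := n) (N := N) (g := cutInv) contDiff_cutInv
    (f := fun x => ∑ k ∈ nbr j, P.ψ k ((2 : ℝ) ^ j • x))
    (ContDiff.sum fun k _ => hψ j k) (by exact_mod_cast hn) x (C := K) (D := 1 + 3 * B)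
    (fun i hi => hK i (hi.trans hn) _ hx) fun i hi1 hi => ?_).trans ?_
  · exact ((hsum j i (hi.trans hn) x).trans (by linarith)).trans
      (le_self_pow₀ (by linarith) (by omega))
  · have h1 : (n.factorial : ℝ) ≤ N.factorial := by exact_mod_cast Nat.factorial_le hn
    have h2 : (1 + 3 * B) ^ n ≤ (1 + 3 * B) ^ N := pow_le_pow_right₀ (by linarith) hn
    gcongr

end DyadicPartition

theorem ofReal_mul_ofReal_mul {a : ℝ} (ha : 0 ≤ a) (b : ℝ) (X : ℝ≥0∞) :
    ENNReal.ofReal a * (ENNReal.ofReal b * X) = ENNReal.ofReal (a * b) * X := by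
  rw [ENNReal.ofReal_mul ha, mul_assoc]

theorem memLp_of_bounded_of_eq_zero {V : Type*} [NormedAddCommGroup V] {f : E3 → V}
    (hf : StronglyMeasurable f) {M R : ℝ} (hM : ∀ x, ‖f x‖ ≤ M) (hR : ∀ x, R < ‖x‖ → f x = 0)
    (p : ℝ≥0∞) : MemLp f p := by
  have hind : (Metric.closedBall (0 : E3) R).indicator f = f :=
    Set.indicator_eq_self.2 fun x hx => by
      by_contra h
      exact hx (hR x (by simpa using h))
  rw [← hind, memLp_indicator_iff_restrict Metric.isClosed_closedBall.measurableSet]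
  have : IsFiniteMeasure (volume.restrict (Metric.closedBall (0 : E3) R)) :=
    ⟨by rw [Measure.restrict_apply_univ]; exact measure_closedBall_lt_top⟩
  exact MemLp.of_bound hf.aestronglyMeasurable M (Filter.Eventually.of_forall hM)

namespace DyadicPartition

variable (P : DyadicPartition)

/-- The dyadic piece `ψ_k u` in the frame dilated by `2 ^ j`. -/
def piece (u : E3 → ℝ) (j k : ℕ) (x : E3) : ℂ :=
  ((P.ψ k ((2 : ℝ) ^ j • x) * u ((2 : ℝ) ^ j • x) : ℝ) : ℂ)

theorem stronglyMeasurable_piece {u : E3 → ℝ} (hu : StronglyMeasurable u) (j k : ℕ) :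
    StronglyMeasurable (P.piece u j k) := by
  have h1 : Continuous fun x : E3 => P.ψ k ((2 : ℝ) ^ j • x) :=
    (P.smooth k).continuous.comp (continuous_const_smul _)
  exact Complex.continuous_ofReal.comp_stronglyMeasurable
    (h1.stronglyMeasurable.mul (hu.comp_measurable (measurable_const_smul _)))

theorem memLp_piece {u : E3 → ℝ} (hu : StronglyMeasurable u) {r : ℝ} (hr : ∀ x, ‖u x‖ ≤ r)
    {j k : ℕ} (hk : k ∈ nbr j) (p : ℝ≥0∞) : MemLp (P.piece u j k) p := by
  obtain ⟨B, hB0, hB⟩ := P.exists_norm_iteratedFDeriv_comp_smul_le 0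
  refine memLp_of_bounded_of_eq_zero (P.stronglyMeasurable_piece hu j k) (M := B * r) (R := 4)
    (fun x => ?_) (fun x hx => ?_) p
  · have h := hB j k hk 0 le_rfl x
    rw [norm_iteratedFDeriv_zero] at h
    rw [piece, Complex.norm_real, norm_mul]
    exact mul_le_mul h (hr _) (norm_nonneg _) hB0
  · rw [piece, P.apply_smul_eq_zero (mem_nbr.1 hk).2 hx]
    simp

theorem piece_eq_comp_smul (u : E3 → ℝ) (j k : ℕ) (x : E3) :
    P.piece u j k x = P.piece u k k (((2 : ℝ) ^ j / 2 ^ k) • x) := by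
  simp only [piece, smul_smul]
  rw [mul_div_cancel₀ _ (by positivity)]

theorem self_mem_nbr (j : ℕ) : j ∈ nbr j := mem_nbr.2 (by omega)

/-- Replacing the frame of a dyadic piece by an adjacent one costs a constant. -/
theorem exists_HsNormSq_piece_le {s : ℝ} (hs : 0 < s) {N : ℕ} (hN : s < N) :
    ∃ C : ℝ, 0 ≤ C ∧ ∀ u : E3 → ℝ, StronglyMeasurable u → ∀ r : ℝ, (∀ x, ‖u x‖ ≤ r) →
      ∀ j k, k ∈ nbr j →
        HsNormSq s (P.piece u j k) ≤ ENNReal.ofReal C * HsNormSq s (P.piece u k k) := by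
  obtain ⟨C₁, hC₁, H₁⟩ := exists_HsNormSq_le_diffNormSq hs N
  obtain ⟨C₂, hC₂, H₂⟩ := exists_diffNormSq_le_HsNormSq hs hN
  refine ⟨C₁ * (8 * (1 + 2 ^ (2 * s)) * C₂), by positivity, fun u hu r hr j k hk => ?_⟩
  have hkk := self_mem_nbr k
  have hc : (0 : ℝ) < (2 : ℝ) ^ j / 2 ^ k := by positivity
  have hc1 : ((((2 : ℝ) ^ j / 2 ^ k)) ^ 3)⁻¹ ≤ 8 := by
    have : (2 : ℝ) ^ k / 2 ^ j ≤ 2 := by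
      rw [div_le_iff₀ (by positivity), ← pow_succ']
      exact pow_le_pow_right₀ (by norm_num) (mem_nbr.1 hk).2
    rw [← inv_pow, inv_div]
    exact (pow_le_pow_left₀ (by positivity) this 3).trans (by norm_num)
  have hc2 : (2 : ℝ) ^ j / 2 ^ k ≤ 2 := by
    rw [div_le_iff₀ (by positivity), ← pow_succ']
    exact pow_le_pow_right₀ (by norm_num) (mem_nbr.1 hk).1
  have hc3 : ((2 : ℝ) ^ j / 2 ^ k) ^ (2 * s) ≤ 2 ^ (2 * s) :=
    Real.rpow_le_rpow hc.le hc2 (by positivity)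
  calc HsNormSq s (P.piece u j k)
      ≤ ENNReal.ofReal C₁ * diffNormSq s N (P.piece u j k) :=
        H₁ _ (memLp_one_iff_integrable.1 (P.memLp_piece hu hr hk 1)) (P.memLp_piece hu hr hk 2)
    _ = ENNReal.ofReal C₁ *
          diffNormSq s N (fun x => P.piece u k k (((2 : ℝ) ^ j / 2 ^ k) • x)) := by
        rw [funext (P.piece_eq_comp_smul u j k)]
    _ ≤ ENNReal.ofReal C₁ * (ENNReal.ofReal (8 * (1 + 2 ^ (2 * s))) *
          (ENNReal.ofReal C₂ * HsNormSq s (P.piece u k k))) := by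
        gcongr
        refine (diffNormSq_comp_smul_le s N (P.piece u k k) hc).trans ?_
        gcongr
        exact H₂ _ (memLp_one_iff_integrable.1 (P.memLp_piece hu hr hkk 1))
          (P.memLp_piece hu hr hkk 2)
    _ = _ := by
        rw [ofReal_mul_ofReal_mul hC₁, ofReal_mul_ofReal_mul (by positivity)]
        congr 2
        ring

/-- The localization of `u` near the `j`-th dyadic piece, in the frame dilated by `2 ^ j`. -/
def localized {m : ℕ} (u : E3 → EuclideanSpace ℝ (Fin m)) (j : ℕ) (x : E3) :
    EuclideanSpace ℝ (Fin m) :=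
  (cutInv (∑ k ∈ nbr j, P.ψ k ((2 : ℝ) ^ j • x)) * ∑ k ∈ nbr j, P.ψ k ((2 : ℝ) ^ j • x)) •
    u ((2 : ℝ) ^ j • x)

theorem localized_eq {m : ℕ} (u : E3 → EuclideanSpace ℝ (Fin m)) {j : ℕ} {x : E3}
    (hx : P.ψ j ((2 : ℝ) ^ j • x) ≠ 0) : P.localized u j x = u ((2 : ℝ) ^ j • x) := by
  rw [localized, cutInv_mul_self_eq_one (P.one_le_sum_nbr hx), one_smul]

theorem norm_localized_le {m : ℕ} {u : E3 → EuclideanSpace ℝ (Fin m)} {r : ℝ}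
    (hr : ∀ x, ‖u x‖ ≤ r) (j : ℕ) (x : E3) : ‖P.localized u j x‖ ≤ r := by
  rw [localized, norm_smul, Real.norm_of_nonneg (cutInv_mul_self_nonneg _)]
  exact (mul_le_of_le_one_left (norm_nonneg _) (cutInv_mul_self_le_one _)).trans (hr _)

theorem localized_eq_zero {m : ℕ} (u : E3 → EuclideanSpace ℝ (Fin m)) (j : ℕ) {x : E3}
    (hx : 4 < ‖x‖) : P.localized u j x = 0 := by
  rw [localized, Finset.sum_eq_zero fun k hk => P.apply_smul_eq_zero (mem_nbr.1 hk).2 hx]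
  simp

theorem contDiff_comp_smul (N : ℕ) (j k : ℕ) :
    ContDiff ℝ N fun x : E3 => P.ψ k ((2 : ℝ) ^ j • x) :=
  ((P.smooth k).of_le (by exact_mod_cast le_top)).comp (contDiff_id.const_smul _)

theorem contDiff_cutInv_sum (N : ℕ) (j : ℕ) :
    ContDiff ℝ N fun x : E3 => cutInv (∑ k ∈ nbr j, P.ψ k ((2 : ℝ) ^ j • x)) :=
  contDiff_cutInv.comp (ContDiff.sum fun k _ => P.contDiff_comp_smul N j k)

theorem stronglyMeasurable_localized {m : ℕ} {u : E3 → EuclideanSpace ℝ (Fin m)}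
    (hu : StronglyMeasurable u) (j : ℕ) : StronglyMeasurable (P.localized u j) := by
  have h1 := (P.contDiff_cutInv_sum 0 j).continuous
  have h2 : Continuous fun x : E3 => ∑ k ∈ nbr j, P.ψ k ((2 : ℝ) ^ j • x) :=
    continuous_finsetSum _ fun k _ => (P.contDiff_comp_smul 0 j k).continuous
  exact (h1.mul h2).stronglyMeasurable.smul (hu.comp_measurable (measurable_const_smul _))

theorem ofReal_localized_apply {m : ℕ} (u : E3 → EuclideanSpace ℝ (Fin m)) (j : ℕ) (i : Fin m)
    (x : E3) : ((P.localized u j x i : ℝ) : ℂ) = ∑ k ∈ nbr j,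
      cutInv (∑ k ∈ nbr j, P.ψ k ((2 : ℝ) ^ j • x)) • P.piece (fun x => u x i) j k x := by
  simp only [localized, piece, PiLp.smul_apply, smul_eq_mul, Complex.real_smul]
  push_cast
  rw [Finset.mul_sum, Finset.sum_mul]
  exact Finset.sum_congr rfl fun k _ => by ring

theorem stronglyMeasurable_apply {m : ℕ} {u : E3 → EuclideanSpace ℝ (Fin m)}
    (hu : StronglyMeasurable u) (i : Fin m) : StronglyMeasurable fun x => u x i :=
  (EuclideanSpace.proj (𝕜 := ℝ) i).continuous.comp_stronglyMeasurable hu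

theorem exists_diffNormSq_localized_le {s : ℝ} (hs : 0 < s) {N : ℕ} (hN : s < N) (m : ℕ) :
    ∃ C : ℝ, 0 ≤ C ∧ ∀ u : E3 → EuclideanSpace ℝ (Fin m), StronglyMeasurable u →
      ∀ r : ℝ, (∀ x, ‖u x‖ ≤ r) → ∀ j, diffNormSq s N (P.localized u j) ≤
        ENNReal.ofReal C * ∑ i, ∑ k ∈ nbr j, HsNormSq s (P.piece (fun x => u x i) k k) := by
  obtain ⟨C₁, hC₁, H₁⟩ := exists_diffNormSq_mul_le hs hN
  obtain ⟨C₂, hC₂, H₂⟩ := P.exists_HsNormSq_piece_le hs hN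
  obtain ⟨B, hB0, hB⟩ := P.exists_norm_iteratedFDeriv_cutInv_comp_smul_le N
  refine ⟨m ^ 2 * (3 ^ 2 * (C₁ * B ^ 2 * C₂)), by positivity, fun u hu r hr j => ?_⟩
  have hui := stronglyMeasurable_apply hu
  have hri : ∀ i x, ‖u x i‖ ≤ r := fun i x => (PiLp.norm_apply_le (u x) i).trans (hr x)
  have hχ := P.contDiff_cutInv_sum N j
  have hi : ∀ i, diffNormSq s N (fun x => P.localized u j x i) ≤
      ENNReal.ofReal (3 ^ 2 * (C₁ * B ^ 2 * C₂)) *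
        ∑ k ∈ nbr j, HsNormSq s (P.piece (fun x => u x i) k k) := by
    intro i
    rw [← diffNormSq_ofReal, funext (P.ofReal_localized_apply u j i)]
    refine (diffNormSq_sum_le s N (nbr j) (f := fun k x =>
      cutInv (∑ k ∈ nbr j, P.ψ k ((2 : ℝ) ^ j • x)) • P.piece (fun x => u x i) j k x)
      fun k _ => hχ.continuous.stronglyMeasurable.smul
        (P.stronglyMeasurable_piece (hui i) j k)).trans ?_
    rw [ENNReal.ofReal_mul (by positivity), mul_assoc]
    refine mul_le_mul' ?_ ?_
    · have : ((nbr j).card : ℝ≥0∞) ≤ 3 := by exact_mod_cast card_nbr_le j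
      refine (pow_le_pow_left' this 2).trans_eq ?_
      rw [ENNReal.ofReal_pow (by norm_num), ENNReal.ofReal_ofNat]
    · rw [Finset.mul_sum]
      refine Finset.sum_le_sum fun k hk => ?_
      refine (H₁ _ hχ B hB0 (hB j) _ (P.stronglyMeasurable_piece (hui i) j k)
        (memLp_one_iff_integrable.1 (P.memLp_piece (hui i) (hri i) hk 1))
        (P.memLp_piece (hui i) (hri i) hk 2)).trans ?_
      rw [← ofReal_mul_ofReal_mul (by positivity) C₂]
      gcongr
      exact H₂ _ (hui i) r (hri i) j k hk
  refine (diffNormSq_le_sum_apply s N (P.stronglyMeasurable_localized hu j)).trans ?_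
  rw [ENNReal.ofReal_mul (by positivity), mul_assoc, ENNReal.ofReal_pow (by positivity),
    ENNReal.ofReal_natCast]
  gcongr
  rw [Finset.mul_sum]
  exact Finset.sum_le_sum fun i _ => hi i

/-- The Moser estimate for a single dyadic piece. -/
theorem exists_HsNormSq_piece_comp_le {s : ℝ} (hs : 0 < s) {N : ℕ} (hN : s < N) (m l : ℕ) :
    ∃ C : ℝ, 0 ≤ C ∧ ∀ F : EuclideanSpace ℝ (Fin m) → EuclideanSpace ℝ (Fin l),
      ContDiff ℝ N F → F 0 = 0 → ∀ r M : ℝ, 0 < r →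
      (∀ k ≤ N, ∀ y, ‖y‖ ≤ r → ‖iteratedFDeriv ℝ k F y‖ ≤ M) →
      ∀ u : E3 → EuclideanSpace ℝ (Fin m), StronglyMeasurable u → (∀ x, ‖u x‖ ≤ r) →
        ∀ j (i : Fin l), HsNormSq s (P.piece (fun x => F (u x) i) j j) ≤
          ENNReal.ofReal (C * (M * (1 + r ^ N)) ^ 2) *
            ∑ i, ∑ k ∈ nbr j, HsNormSq s (P.piece (fun x => u x i) k k) := by
  obtain ⟨C₁, hC₁, H₁⟩ := exists_HsNormSq_le_diffNormSq hs N
  obtain ⟨C₂, hC₂, H₂⟩ := exists_diffNormSq_mul_le hs hN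
  obtain ⟨C₃, hC₃, H₃⟩ := exists_diffNormSq_comp_le_of_bound (EuclideanSpace ℝ (Fin m))
    (EuclideanSpace ℝ (Fin l)) hs hN
  obtain ⟨C₄, hC₄, H₄⟩ := P.exists_diffNormSq_localized_le hs hN m
  obtain ⟨B, hB0, hB⟩ := P.exists_norm_iteratedFDeriv_comp_smul_le N
  refine ⟨C₁ * (C₂ * B ^ 2) * C₁ * C₃ * C₄, by positivity,
    fun F hF hF0 r M hr hM u hu hur j i => ?_⟩
  have hv := P.stronglyMeasurable_localized hu j
  have hvr := P.norm_localized_le hur j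
  have hFM : ∀ y, ‖y‖ ≤ r → ‖F y‖ ≤ M := fun y hy => by
    have := hM 0 (Nat.zero_le _) y hy
    rwa [norm_iteratedFDeriv_zero] at this
  have hFi : ∀ y, ‖y‖ ≤ r → ‖F y i‖ ≤ M := fun y hy => (PiLp.norm_apply_le _ i).trans (hFM y hy)
  have hgm : StronglyMeasurable fun x => ((F (P.localized u j x) i : ℝ) : ℂ) :=
    Complex.continuous_ofReal.comp_stronglyMeasurable
      (stronglyMeasurable_apply (hF.continuous.comp_stronglyMeasurable hv) i)
  have hg : ∀ p, MemLp (fun x => ((F (P.localized u j x) i : ℝ) : ℂ)) p := fun p =>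
    memLp_of_bounded_of_eq_zero hgm (M := M) (R := 4)
      (fun x => by rw [Complex.norm_real]; exact hFi _ (hvr x))
      (fun x hx => by rw [P.localized_eq_zero u j hx, hF0]; simp) p
  have heq : P.piece (fun x => F (u x) i) j j = fun x =>
      P.ψ j ((2 : ℝ) ^ j • x) • ((F (P.localized u j x) i : ℝ) : ℂ) := by
    funext x
    rw [piece, Complex.real_smul, ← Complex.ofReal_mul]
    by_cases hx : P.ψ j ((2 : ℝ) ^ j • x) = 0
    · rw [hx, zero_mul, zero_mul]
    · rw [P.localized_eq u hx]
  have hFu : ∀ p, MemLp (P.piece (fun x => F (u x) i) j j) p := fun p =>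
    P.memLp_piece (stronglyMeasurable_apply (hF.continuous.comp_stronglyMeasurable hu) i)
      (fun x => hFi _ (hur x)) (self_mem_nbr j) p
  have hv2 : ∫⁻ x, ‖P.localized u j x‖ₑ ^ 2 < ⊤ := by
    have h2 := (memLp_of_bounded_of_eq_zero hv hvr (fun x hx => P.localized_eq_zero u j hx) 2)
    have := lintegral_rpow_enorm_lt_top_of_eLpNorm_lt_top (by norm_num) (by norm_num) h2.2
    simpa using this
  calc HsNormSq s (P.piece (fun x => F (u x) i) j j)
      ≤ ENNReal.ofReal C₁ * diffNormSq s N (P.piece (fun x => F (u x) i) j j) :=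
        H₁ _ (memLp_one_iff_integrable.1 (hFu 1)) (hFu 2)
    _ ≤ ENNReal.ofReal C₁ * (ENNReal.ofReal (C₂ * B ^ 2) *
          HsNormSq s (fun x => ((F (P.localized u j x) i : ℝ) : ℂ))) := by
        rw [heq]
        gcongr
        exact H₂ _ (P.contDiff_comp_smul N j j) B hB0 (hB j j (self_mem_nbr j)) _ hgm
          (memLp_one_iff_integrable.1 (hg 1)) (hg 2)
    _ ≤ ENNReal.ofReal C₁ * (ENNReal.ofReal (C₂ * B ^ 2) * (ENNReal.ofReal C₁ *
          (ENNReal.ofReal (C₃ * (M * (1 + r ^ N)) ^ 2) * (ENNReal.ofReal C₄ *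
            ∑ i, ∑ k ∈ nbr j, HsNormSq s (P.piece (fun x => u x i) k k))))) := by
        gcongr
        refine (H₁ _ (memLp_one_iff_integrable.1 (hg 1)) (hg 2)).trans ?_
        gcongr
        rw [diffNormSq_ofReal]
        refine (diffNormSq_apply_le s N (fun x => F (P.localized u j x)) i).trans ?_
        refine (H₃ F hF hF0 r M hr hM _ hv hvr hv2).trans ?_
        gcongr
        exact H₄ u hu r hur j
    _ = _ := by
        rw [ofReal_mul_ofReal_mul (by positivity), ofReal_mul_ofReal_mul (by positivity),
          ofReal_mul_ofReal_mul (by positivity), ofReal_mul_ofReal_mul (by positivity)]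
        congr 2
        ring

end DyadicPartition

theorem HsNormSq_congr_ae (s : ℝ) {f g : E3 → ℂ} (h : f =ᵐ[volume] g) :
    HsNormSq s f = HsNormSq s g := by
  unfold HsNormSq
  simp only [Real.fourier_congr_ae h]

theorem comp_smul_ae_eq {V : Type*} {f g : E3 → V} (h : f =ᵐ[volume] g) {c : ℝ} (hc : c ≠ 0) :
    (fun x => f (c • x)) =ᵐ[volume] fun x => g (c • x) := by
  refine Measure.QuasiMeasurePreserving.ae_eq_comp (f := fun x : E3 => c • x)
    ⟨measurable_const_smul c, ?_⟩ h
  rw [Measure.map_addHaar_smul volume hc]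
  exact Measure.smul_absolutelyContinuous

theorem HwNormSq_congr_ae (P : DyadicPartition) (s δ : ℝ) {u v : E3 → ℝ} (h : u =ᵐ[volume] v) :
    HwNormSq P s δ u = HwNormSq P s δ v := by
  unfold HwNormSq
  refine tsum_congr fun j => ?_
  congr 1
  refine HsNormSq_congr_ae s ?_
  filter_upwards [comp_smul_ae_eq h (c := (2 : ℝ) ^ j) (by positivity)] with x hx
  rw [hx]

theorem HwNormSq_zero (P : DyadicPartition) (s δ : ℝ) : HwNormSq P s δ (fun _ => 0) = 0 := by
  simp [HwNormSq, HsNormSq, Real.fourier_eq]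

namespace DyadicPartition

theorem mem_nbr_comm {j k : ℕ} : k ∈ nbr j ↔ j ∈ nbr k := by
  rw [mem_nbr, mem_nbr, and_comm]

theorem tsum_sum_nbr_le (a : ℕ → ℝ≥0∞) : ∑' j, ∑ k ∈ nbr j, a k ≤ 3 * ∑' k, a k := by
  have h : ∀ j, ∑ k ∈ nbr j, a k = ∑' k, if k ∈ nbr j then a k else 0 := fun j => by
    rw [tsum_eq_sum (s := nbr j) fun k hk => if_neg hk]
    exact Finset.sum_congr rfl fun k hk => (if_pos hk).symm
  simp only [h]
  rw [ENNReal.tsum_comm, ← ENNReal.tsum_mul_left]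
  refine ENNReal.tsum_le_tsum fun k => ?_
  rw [tsum_eq_sum (s := nbr k) fun j hj => if_neg fun hk => hj (mem_nbr_comm.1 hk)]
  rw [Finset.sum_congr rfl fun j hj => if_pos (mem_nbr_comm.2 hj), Finset.sum_const, nsmul_eq_mul]
  gcongr
  exact_mod_cast card_nbr_le k

theorem weight_le_of_mem_nbr (a : ℝ) {j k : ℕ} (hk : k ∈ nbr j) :
    ENNReal.ofReal ((2 : ℝ) ^ (a * (j : ℝ))) ≤
      ENNReal.ofReal ((2 : ℝ) ^ |a|) * ENNReal.ofReal ((2 : ℝ) ^ (a * (k : ℝ))) := by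
  rw [← ENNReal.ofReal_mul (by positivity), ← Real.rpow_add (by norm_num)]
  refine ENNReal.ofReal_le_ofReal (Real.rpow_le_rpow_of_exponent_le (by norm_num) ?_)
  obtain ⟨h1, h2⟩ := mem_nbr.1 hk
  have h1' : (j : ℝ) ≤ k + 1 := by exact_mod_cast h1
  have h2' : (k : ℝ) ≤ j + 1 := by exact_mod_cast h2
  rcases abs_cases a with ⟨h, h0⟩ | ⟨h, h0⟩ <;> rw [h] <;> nlinarith

end DyadicPartition

open DyadicPartition in
/-- The weighted Moser estimate for everywhere bounded, strongly measurable functions. -/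
theorem exists_HwNormSq_comp_le (P : DyadicPartition) {s : ℝ} (δ : ℝ) (hs : 0 < s) {N : ℕ}
    (hN : s < N) (m l : ℕ) :
    ∃ C : ℝ, 0 ≤ C ∧ ∀ F : EuclideanSpace ℝ (Fin m) → EuclideanSpace ℝ (Fin l),
      ContDiff ℝ N F → F 0 = 0 → ∀ r M : ℝ, 0 < r →
      (∀ k ≤ N, ∀ y, ‖y‖ ≤ r → ‖iteratedFDeriv ℝ k F y‖ ≤ M) →
      ∀ u : E3 → EuclideanSpace ℝ (Fin m), StronglyMeasurable u → (∀ x, ‖u x‖ ≤ r) →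
        ∀ i : Fin l, HwNormSq P s δ (fun x => F (u x) i) ≤
          ENNReal.ofReal (C * (M * (1 + r ^ N)) ^ 2) * ∑ i, HwNormSq P s δ (fun x => u x i) := by
  obtain ⟨C, hC, H⟩ := P.exists_HsNormSq_piece_comp_le hs hN m l
  refine ⟨C * (2 ^ |3 + 2 * δ| * 3), by positivity, fun F hF hF0 r M hr hM u hu hur i => ?_⟩
  set K := M * (1 + r ^ N)
  set w : ℕ → ℝ≥0∞ := fun j => ENNReal.ofReal ((2 : ℝ) ^ ((3 + 2 * δ) * (j : ℝ))) with hw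
  set a : Fin m → ℕ → ℝ≥0∞ := fun i k => HsNormSq s (P.piece (fun x => u x i) k k) with ha
  have hHw : ∀ i, HwNormSq P s δ (fun x => u x i) = ∑' k, w k * a i k := fun i => rfl
  calc HwNormSq P s δ (fun x => F (u x) i)
      = ∑' j, w j * HsNormSq s (P.piece (fun x => F (u x) i) j j) := rfl
    _ ≤ ∑' j, ENNReal.ofReal (C * K ^ 2) *
          (ENNReal.ofReal (2 ^ |3 + 2 * δ|) * ∑ k ∈ nbr j, ∑ i, w k * a i k) := by
        refine ENNReal.tsum_le_tsum fun j => ?_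
        refine (mul_le_mul_right (H F hF hF0 r M hr hM u hu hur j i) _).trans ?_
        rw [mul_left_comm]
        refine mul_le_mul_right ?_ _
        rw [Finset.sum_comm, Finset.mul_sum, Finset.mul_sum]
        refine Finset.sum_le_sum fun k hk => ?_
        rw [← Finset.mul_sum, ← mul_assoc]
        gcongr
        exact weight_le_of_mem_nbr _ hk
    _ ≤ ENNReal.ofReal (C * K ^ 2) *
          (ENNReal.ofReal (2 ^ |3 + 2 * δ|) * (3 * ∑' k, ∑ i, w k * a i k)) := by
        rw [ENNReal.tsum_mul_left, ENNReal.tsum_mul_left]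
        gcongr
        exact tsum_sum_nbr_le _
    _ = _ := by
        rw [Summable.tsum_finsetSum fun i _ => ENNReal.summable]
        simp only [hHw]
        rw [← ENNReal.ofReal_ofNat, ofReal_mul_ofReal_mul (by positivity),
          ofReal_mul_ofReal_mul (by positivity)]
        congr 2
        ring

/-- A bounded function has, up to null sets, a strongly measurable representative with the same
pointwise bound. -/
theorem exists_stronglyMeasurable_bounded_ae_eq {V : Type*} [NormedAddCommGroup V]
    {u : E3 → V} (hu : AEStronglyMeasurable u) {r : ℝ} (hr0 : 0 ≤ r) (hr : ∀ x, ‖u x‖ ≤ r) :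
    ∃ v : E3 → V, StronglyMeasurable v ∧ (∀ x, ‖v x‖ ≤ r) ∧ u =ᵐ[volume] v := by
  have hm := hu.stronglyMeasurable_mk
  refine ⟨{x | ‖hu.mk u x‖ ≤ r}.indicator (hu.mk u),
    hm.indicator (measurableSet_le hm.norm.measurable measurable_const), fun x => ?_, ?_⟩
  · by_cases hx : x ∈ {x | ‖hu.mk u x‖ ≤ r}
    · rw [Set.indicator_of_mem hx]; exact hx
    · rw [Set.indicator_of_notMem hx, norm_zero]; exact hr0
  · filter_upwards [hu.ae_eq_mk] with x hx
    rw [Set.indicator_of_mem, hx]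
    change ‖hu.mk u x‖ ≤ r
    rw [← hx]
    exact hr x

theorem locallyIntegrable_of_bounded {f : E3 → ℝ} (hf : AEStronglyMeasurable f) {M : ℝ}
    (hM : ∀ x, ‖f x‖ ≤ M) : LocallyIntegrable f := by
  have h := (memLp_top_of_bound hf M (Filter.Eventually.of_forall hM)).locallyIntegrable le_top
  exact h

theorem sqrt_sum_toReal_le {ι : Type*} (t : Finset ι) {a : ι → ℝ≥0∞} (ha : ∀ i ∈ t, a i ≠ ⊤) :
    √(∑ i ∈ t, a i).toReal ≤ ∑ i ∈ t, √(a i).toReal := by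
  rw [ENNReal.toReal_sum ha]
  refine Real.sqrt_le_iff.2 ⟨Finset.sum_nonneg fun i _ => Real.sqrt_nonneg _, ?_⟩
  refine le_trans (Finset.sum_le_sum fun i _ => (Real.sq_sqrt ENNReal.toReal_nonneg).ge) ?_
  exact Finset.sum_sq_le_sq_sum_of_nonneg fun i _ => Real.sqrt_nonneg _

/-- Moser type estimate.
Let `s > 0`, `N ≥ ⌊s⌋ + 1` and `F : ℝ^m → ℝ^l` a `C^{N+1}` function with `F(0) = 0`.
Then there is a constant `C` such that for every bounded `u ∈ H_{s,δ}(ℝ³;ℝ^m)`,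
`F(u) ∈ H_{s,δ}(ℝ³;ℝ^l)` and
`‖F(u)‖_{H_{s,δ}} ≤ C ‖F‖_{C^{N+1}} (1 + ‖u‖_{L^∞}^N) ‖u‖_{H_{s,δ}}`, where
`‖F‖_{C^{N+1}}` is any bound for the partial derivatives of `F` of order `≤ N+1` on the
ball of radius `‖u‖_{L^∞}`. -/
theorem moser_estimate (P : DyadicPartition) (s δ : ℝ) (hs : 0 < s)
    (m l N : ℕ) (hN : ⌊s⌋ + 1 ≤ (N : ℤ))
    (F : EuclideanSpace ℝ (Fin m) → EuclideanSpace ℝ (Fin l))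
    (hF : ContDiff ℝ ((N : ℕ∞) + 1) F) (hF0 : F 0 = 0) :
    ∃ C : ℝ, 0 < C ∧ ∀ (u : E3 → EuclideanSpace ℝ (Fin m)) (Mu MF : ℝ),
      0 ≤ Mu →
      (∀ x : E3, ‖u x‖ ≤ Mu) →
      (∀ k : ℕ, k ≤ N + 1 → ∀ y : EuclideanSpace ℝ (Fin m), ‖y‖ ≤ Mu →
        ‖iteratedFDeriv ℝ k F y‖ ≤ MF) →
      (∀ i : Fin m, MemH P s δ (fun x => u x i)) →
      (∀ i : Fin l, MemH P s δ (fun x => F (u x) i)) ∧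
      (∑ i : Fin l, Hnorm P s δ (fun x => F (u x) i)) ≤
        C * MF * (1 + Mu ^ N) * ∑ i : Fin m, Hnorm P s δ (fun x => u x i) := by
  have hsN : s < N := by
    refine (Int.lt_floor_add_one s).trans_le ?_
    exact_mod_cast hN
  have hFN : ContDiff ℝ N F := hF.of_le (by exact_mod_cast le_self_add)
  obtain ⟨C, hC, H⟩ := exists_HwNormSq_comp_le P δ hs hsN m l
  refine ⟨l * √C + 1, by positivity, fun u Mu MF hMu hu hMF hmem => ?_⟩
  have hMF0 : 0 ≤ MF :=
    (norm_nonneg _).trans (hMF 0 (Nat.zero_le _) 0 (by simpa using hMu))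
  have hae : AEStronglyMeasurable u := by
    have h : AEMeasurable fun x i => u x i :=
      aemeasurable_pi_lambda _ fun i => (hmem i).1.aestronglyMeasurable.aemeasurable
    exact (PiLp.continuous_toLp 2 _).comp_aestronglyMeasurable h.aestronglyMeasurable
  have hFu : ∀ x i, ‖F (u x) i‖ ≤ MF := fun x i => by
    have h := hMF 0 (Nat.zero_le _) (u x) (hu x)
    rw [norm_iteratedFDeriv_zero] at h
    exact (PiLp.norm_apply_le _ i).trans h
  have key : ∀ i, HwNormSq P s δ (fun x => F (u x) i) ≤
      ENNReal.ofReal (C * (MF * (1 + Mu ^ N)) ^ 2) * ∑ i, HwNormSq P s δ (fun x => u x i) := by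
    intro i
    rcases hMu.eq_or_lt with h0 | hpos
    · have hz : ∀ x, F (u x) i = 0 := fun x => by
        have : u x = 0 := norm_le_zero_iff.1 ((hu x).trans_eq h0.symm)
        rw [this, hF0, PiLp.zero_apply]
      simp only [hz, HwNormSq_zero, zero_le]
    · obtain ⟨v, hv, hvr, huv⟩ := exists_stronglyMeasurable_bounded_ae_eq hae hMu hu
      have h := H F hFN hF0 Mu MF hpos (fun k hk => hMF k (by omega)) v hv hvr i
      have h1 : HwNormSq P s δ (fun x => F (u x) i) = HwNormSq P s δ (fun x => F (v x) i) :=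
        HwNormSq_congr_ae P s δ (by filter_upwards [huv] with x hx; rw [hx])
      have h2 : ∀ i, HwNormSq P s δ (fun x => u x i) = HwNormSq P s δ (fun x => v x i) := fun i =>
        HwNormSq_congr_ae P s δ (by filter_upwards [huv] with x hx; rw [hx])
      simpa only [h1, h2] using h
  have hsum : ∑ i, HwNormSq P s δ (fun x => u x i) < ⊤ :=
    ENNReal.sum_lt_top.2 fun i _ => (hmem i).2
  refine ⟨fun i => ⟨locallyIntegrable_of_bounded ?_ fun x => hFu x i,
    (key i).trans_lt (ENNReal.mul_lt_top ENNReal.ofReal_lt_top hsum)⟩, ?_⟩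
  · exact ((EuclideanSpace.proj (𝕜 := ℝ) i).continuous.comp hFN.continuous).comp_aestronglyMeasurable
      hae
  · set S := ∑ i, Hnorm P s δ (fun x => u x i)
    have hS0 : 0 ≤ S := Finset.sum_nonneg fun i _ => Real.sqrt_nonneg _
    have hi : ∀ i, Hnorm P s δ (fun x => F (u x) i) ≤ √C * (MF * (1 + Mu ^ N)) * S := by
      intro i
      have h := ENNReal.toReal_mono (ENNReal.mul_ne_top ENNReal.ofReal_ne_top hsum.ne) (key i)
      rw [ENNReal.toReal_mul, ENNReal.toReal_ofReal (by positivity)] at h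
      refine (Real.sqrt_le_sqrt h).trans ?_
      rw [Real.sqrt_mul (by positivity), Real.sqrt_mul hC, Real.sqrt_sq (by positivity)]
      gcongr
      exact sqrt_sum_toReal_le _ fun i _ => (hmem i).2.ne
    calc ∑ i, Hnorm P s δ (fun x => F (u x) i)
        ≤ ∑ _i : Fin l, √C * (MF * (1 + Mu ^ N)) * S := Finset.sum_le_sum fun i _ => hi i
      _ = l * √C * MF * (1 + Mu ^ N) * S := by
          rw [Finset.sum_const, Finset.card_univ, Fintype.card_fin, nsmul_eq_mul]; ring
      _ ≤ (l * √C + 1) * MF * (1 + Mu ^ N) * S := by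
          gcongr
          linarith
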